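/- arXiv:1006.3407 — 4 statements merged into one kernel-verified Lean document; each statement's English description precedes it below -/
import Mathlib

section
/- Let O be an octonion algebra over ℂ with norm N. The map μ : O → End_ℂ(O ⊕ O), u ↦ [[0, L_u],[−L_{ū}, 0]], extends uniquely to an isomorphism of associative ℂ-algebras from the Clifford algebra Cliff(O, N) (with convention v·v = −N(v)) onto End_ℂ(O ⊕ O). -/
open QuadraticMap

variable {A : Type*} [NonAssocRing A] [Module ℂ A]
  [SMulCommClass ℂ A A] [IsScalarTower ℂ A A]

/-- The block operator `μ(u) = [[0, L_u], [−L_{ū}, 0]]` on `O ⊕ O`. -/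
def muOp (conjO : A →ₗ[ℂ] A) (u : A) : (A × A) →ₗ[ℂ] (A × A) :=
  LinearMap.prod
    ((LinearMap.mulLeft ℂ u).comp (LinearMap.snd ℂ A A))
    (-((LinearMap.mulLeft ℂ (conjO u)).comp (LinearMap.fst ℂ A A)))


namespace CliffHelp

open CliffordAlgebra

section general

variable {V : Type*} [AddCommGroup V] [Module ℂ V] (Q : QuadraticForm ℂ V)

/-- The degree filtration, shifted by one: `G 0 = ⊥`, `G 1 = ℂ`, `G (n+1) = ℂ + V * G n`. -/
noncomputable def G : ℕ → Submodule ℂ (CliffordAlgebra Q)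
  | 0 => ⊥
  | n + 1 => 1 ⊔ LinearMap.range (ι Q) * G n

lemma G_succ_induction {n : ℕ} {p : CliffordAlgebra Q → Prop}
    (hc : ∀ c : ℂ, p (algebraMap ℂ _ c))
    (hm : ∀ (v : V) (y : CliffordAlgebra Q), y ∈ G Q n → p (ι Q v * y))
    (ha : ∀ x y, p x → p y → p (x + y))
    {x : CliffordAlgebra Q} (hx : x ∈ G Q (n + 1)) : p x := by
  obtain ⟨a, h1, b, hb, rfl⟩ := Submodule.mem_sup.1 hx
  obtain ⟨c, rfl⟩ := Submodule.mem_one.1 h1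
  refine ha _ _ (hc c) ?_
  refine Submodule.mul_induction_on hb ?_ ha
  rintro _ ⟨v, rfl⟩ y hy
  exact hm v y hy

lemma algebraMap_mem_G (n : ℕ) (c : ℂ) : algebraMap ℂ (CliffordAlgebra Q) c ∈ G Q (n + 1) :=
  Submodule.mem_sup_left (Submodule.mem_one.2 ⟨c, rfl⟩)

lemma mul_mem_G {n : ℕ} (v : V) {y : CliffordAlgebra Q} (hy : y ∈ G Q n) :
    ι Q v * y ∈ G Q (n + 1) :=
  Submodule.mem_sup_right (Submodule.mul_mem_mul ⟨v, rfl⟩ hy)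

lemma G_le_succ (n : ℕ) : G Q n ≤ G Q (n + 1) := by
  induction n with
  | zero => exact bot_le
  | succ n ih =>
    intro x hx
    refine G_succ_induction Q (fun c => algebraMap_mem_G Q _ c)
      (fun v y hy => mul_mem_G Q v (ih hy)) (fun x y => Submodule.add_mem _) hx

lemma G_mono : Monotone (G Q) := monotone_nat_of_le_succ (G_le_succ Q)

lemma exists_mem_G (x : CliffordAlgebra Q) : ∃ n, x ∈ G Q n := by
  induction x using CliffordAlgebra.left_induction with
  | algebraMap c => exact ⟨1, algebraMap_mem_G Q 0 c⟩
  | add x y hx hy =>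
    obtain ⟨n, hn⟩ := hx
    obtain ⟨m, hm⟩ := hy
    exact ⟨max n m, Submodule.add_mem _ (G_mono Q (le_max_left _ _) hn)
      (G_mono Q (le_max_right _ _) hm)⟩
  | ι_mul x v hx =>
    obtain ⟨n, hn⟩ := hx
    exact ⟨n + 1, mul_mem_G Q v hn⟩

lemma contract_mem_G (d : Module.Dual ℂ V) (n : ℕ) {x : CliffordAlgebra Q}
    (hx : x ∈ G Q (n + 1)) : contractLeft d x ∈ G Q n := by
  induction n generalizing x with
  | zero =>
    refine G_succ_induction Q (p := fun x => contractLeft d x ∈ G Q 0) ?_ ?_ ?_ hx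
    · intro c; rw [contractLeft_algebraMap]; exact zero_mem _
    · intro v y hy
      have : y = 0 := by simpa [G] using hy
      rw [this, mul_zero, map_zero]; exact zero_mem _
    · intro x y hx hy; rw [map_add]; exact add_mem hx hy
  | succ n ih =>
    refine G_succ_induction Q (p := fun x => contractLeft d x ∈ G Q (n + 1)) ?_ ?_ ?_ hx
    · intro c; rw [contractLeft_algebraMap]; exact zero_mem _
    · intro v y hy
      rw [contractLeft_ι_mul]
      exact sub_mem (Submodule.smul_mem _ _ hy) (mul_mem_G Q v (ih hy))
    · intro x y hx hy; rw [map_add]; exact add_mem hx hy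

variable {I : Type*} [Fintype I] (b : Module.Basis I ℂ V)

/-- The Euler operator. -/
noncomputable def euler (x : CliffordAlgebra Q) : CliffordAlgebra Q :=
  ∑ i, ι Q (b i) * contractLeft (b.coord i) x

lemma euler_add (x y : CliffordAlgebra Q) : euler Q b (x + y) = euler Q b x + euler Q b y := by
  simp [euler, mul_add, Finset.sum_add_distrib]

lemma euler_ι_mul (v : V) (y : CliffordAlgebra Q) :
    euler Q b (ι Q v * y) = ι Q v * y + ι Q v * euler Q b y
      - ∑ i, polar Q (b i) v • contractLeft (b.coord i) y := by
  have h1 : ι Q v * y = ∑ i, b.coord i v • (ι Q (b i) * y) := by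
    conv_lhs => rw [← b.sum_repr v]
    rw [map_sum, Finset.sum_mul]
    simp
  have h2 : ∀ i, ι Q (b i) * contractLeft (b.coord i) (ι Q v * y)
      = b.coord i v • (ι Q (b i) * y) + ι Q v * (ι Q (b i) * contractLeft (b.coord i) y)
        - polar Q (b i) v • contractLeft (b.coord i) y := by
    intro i
    rw [contractLeft_ι_mul, Algebra.smul_def (polar Q (b i) v), ← ι_mul_ι_add_swap, mul_sub,
      add_mul, mul_assoc, mul_assoc, mul_smul_comm]
    abel
  unfold euler
  rw [Finset.sum_congr rfl (fun i _ => h2 i), Finset.sum_sub_distrib, Finset.sum_add_distrib,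
    ← h1, Finset.mul_sum]

lemma euler_sub_mem (n : ℕ) {x : CliffordAlgebra Q} (hx : x ∈ G Q (n + 1)) :
    euler Q b x - (n : ℂ) • x ∈ G Q n := by
  induction n generalizing x with
  | zero =>
    have h : ∀ i, contractLeft (b.coord i) x = 0 := by
      intro i
      have := contract_mem_G Q (b.coord i) 0 hx
      simpa [G] using this
    simp [euler, h]
  | succ n ih =>
    refine G_succ_induction Q
      (p := fun x => euler Q b x - ((n + 1 : ℕ) : ℂ) • x ∈ G Q (n + 1)) ?_ ?_ ?_ hx
    · intro c
      have : euler Q b (algebraMap ℂ _ c) = 0 := by simp [euler]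
      rw [this]
      exact sub_mem (zero_mem _) (Submodule.smul_mem _ _ (algebraMap_mem_G Q n c))
    · intro v y hy
      have e : euler Q b (ι Q v * y) - ((n + 1 : ℕ) : ℂ) • (ι Q v * y)
          = ι Q v * (euler Q b y - (n : ℂ) • y)
            - ∑ i, polar Q (b i) v • contractLeft (b.coord i) y := by
        rw [euler_ι_mul, mul_sub, mul_smul_comm]
        push_cast
        module
      rw [e]
      refine sub_mem (mul_mem_G Q v (ih hy)) (sum_mem fun i _ => Submodule.smul_mem _ _ ?_)
      exact G_le_succ Q n (contract_mem_G Q _ n hy)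
    · intro x y hx hy
      rw [euler_add, smul_add, add_sub_add_comm]
      exact add_mem hx hy

lemma eq_bot_of_contract {I : Type*} [Fintype I] (b : Module.Basis I ℂ V)
    (K : Submodule ℂ (CliffordAlgebra Q))
    (hK : ∀ (d : Module.Dual ℂ V), ∀ x ∈ K, contractLeft d x ∈ K)
    (h1 : ∀ c : ℂ, algebraMap ℂ (CliffordAlgebra Q) c ∈ K → c = 0) :
    ∀ x ∈ K, x = 0 := by
  have key : ∀ n, ∀ x ∈ K, x ∈ G Q n → x = 0 := by
    intro n
    induction n with
    | zero => intro x _ hx; simpa [G] using hx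
    | succ n ih =>
      intro x hxK hx
      rcases Nat.eq_zero_or_pos n with rfl | hn
      · have : x ∈ (1 : Submodule ℂ (CliffordAlgebra Q)) := by simpa [G] using hx
        obtain ⟨c, rfl⟩ := Submodule.mem_one.1 this
        rw [h1 c hxK, map_zero]
      · have h0 : euler Q b x = 0 := by
          unfold euler
          refine Finset.sum_eq_zero fun i _ => ?_
          rw [ih _ (hK _ x hxK) (contract_mem_G Q _ n hx), mul_zero]
        have h2 := euler_sub_mem Q b n hx
        rw [h0, zero_sub, neg_mem_iff] at h2
        have hn' : (n : ℂ) ≠ 0 := by exact_mod_cast hn.ne'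
        exact ih x hxK ((Submodule.smul_mem_iff _ hn').1 h2)
  intro x hx
  obtain ⟨n, hn⟩ := exists_mem_G Q x
  exact key n x hx hn

lemma contract_polar (v : V) (x : CliffordAlgebra Q) :
    contractLeft (Q.polarBilin v) x = ι Q v * x - involute x * ι Q v := by
  induction x using CliffordAlgebra.left_induction with
  | algebraMap c => simp [Algebra.commutes]
  | add x y hx hy => rw [map_add, hx, hy, map_add, mul_add, add_mul]; abel
  | ι_mul x w hx =>
    rw [contractLeft_ι_mul, hx, map_mul, involute_ι, QuadraticMap.polarBilin_apply_apply,
      Algebra.smul_def, ← ι_mul_ι_add_swap]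
    noncomm_ring

lemma finrank_clifford (hdim : Module.finrank ℂ V = 8) :
    FiniteDimensional ℂ (CliffordAlgebra Q) ∧ Module.finrank ℂ (CliffordAlgebra Q) = 256 := by
  have : FiniteDimensional ℂ V := FiniteDimensional.of_finrank_pos (by omega)
  let c : Module.Basis (Fin 8) ℂ V := Module.finBasisOfFinrankEq ℂ V hdim
  have : Invertible (2 : ℂ) := invertibleOfNonzero two_ne_zero
  let B : Module.Basis (Finset (Fin 8)) ℂ (CliffordAlgebra Q) :=
    c.ExteriorAlgebra.map (equivExterior Q).symm
  refine ⟨Module.Finite.of_basis B, ?_⟩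
  rw [Module.finrank_eq_card_basis B]
  simp

end general

section comp

variable {O : Type*} [NonAssocRing O] [Module ℂ O]
  [IsScalarTower ℂ O O] (N : QuadraticForm ℂ O)

lemma conj_mul_mul (hmul : ∀ x y : O, N (x * y) = N x * N y)
    (hnondeg : ∀ x : O, (∀ y : O, polar N x y = 0) → x = 0)
    (x y : O) : (polar N x 1 • (1 : O) - x) * (x * y) = N x • y := by
  have hA : ∀ x y z, polar N (x * y) (x * z) = N x * polar N y z := by
    intro x y z
    simp only [polar, ← mul_add, hmul]; ring
  have hB : ∀ x y z, polar N (x * y) z + polar N y (x * z) = polar N x 1 * polar N y z := by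
    intro x y z
    have h1 := hA (x + 1) y z
    have h2 := hA x y z
    have h3 := hA 1 y z
    have h4 : N (x + 1) = polar N x 1 + N x + N 1 := by simp only [polar]; ring
    simp only [add_mul, one_mul, QuadraticMap.polar_add_left, QuadraticMap.polar_add_right] at h1 h3
    rw [h4] at h1
    linear_combination h1 - h2 - h3
  rw [← sub_eq_zero]
  refine hnondeg _ fun z => ?_
  rw [sub_mul, smul_mul_assoc, one_mul, QuadraticMap.polar_sub_left, QuadraticMap.polar_sub_left,
    QuadraticMap.polar_smul_left, QuadraticMap.polar_smul_left, smul_eq_mul, smul_eq_mul]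
  linear_combination hA x y z - hB x (x * y) z

lemma mul_conj_mul [SMulCommClass ℂ O O] (hmul : ∀ x y : O, N (x * y) = N x * N y)
    (hnondeg : ∀ x : O, (∀ y : O, polar N x y = 0) → x = 0)
    (x y : O) : x * ((polar N x 1 • (1 : O) - x) * y) = N x • y := by
  rw [← conj_mul_mul N hmul hnondeg, sub_mul, sub_mul, smul_mul_assoc, smul_mul_assoc, one_mul,
    one_mul, mul_sub, mul_smul_comm]

end comp

end CliffHelp

/-- For the complex octonion algebra `O` with norm `N`, the map
`μ : O → End_ℂ(O ⊕ O)`, `u ↦ [[0, L_u], [−L_{ū}, 0]]`, extends uniquely to an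
isomorphism of associative `ℂ`-algebras `Cliff(O, N) ≃ End_ℂ(O ⊕ O)`, where the
Clifford algebra uses the convention `v·v = −N(v)`. -/
theorem clifford_iso_end (N : QuadraticForm ℂ A)
    (hmul : ∀ x y : A, N (x * y) = N x * N y)
    (hnondeg : ∀ x : A, (∀ y : A, polar N x y = 0) → x = 0)
    (hdim : Module.finrank ℂ A = 8)
    (conjO : A →ₗ[ℂ] A)
    (hconj : ∀ x : A, conjO x = polar N x 1 • (1 : A) - x) :
    ∃! f : CliffordAlgebra (-N) ≃ₐ[ℂ] Module.End ℂ (A × A),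
      ∀ u : A, f (CliffordAlgebra.ι (-N) u) = muOp conjO u := by
  have hconj_u : ∀ u a : A, conjO u * (u * a) = N u • a := fun u a => by
    rw [hconj]; exact CliffHelp.conj_mul_mul N hmul hnondeg u a
  have hu_conj : ∀ u a : A, u * (conjO u * a) = N u • a := fun u a => by
    rw [hconj]; exact CliffHelp.mul_conj_mul N hmul hnondeg u a
  have : FiniteDimensional ℂ A := FiniteDimensional.of_finrank_pos (by omega)
  have : Nontrivial A := Module.nontrivial_of_finrank_pos (R := ℂ) (by omega)
  let m : A →ₗ[ℂ] Module.End ℂ (A × A) :=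
    { toFun := muOp conjO
      map_add' := fun u v => by
        ext x <;> simp [muOp, add_mul, add_comm]
      map_smul' := fun c u => by
        ext x <;> simp [muOp, smul_mul_assoc] }
  have hm : ∀ u, m u * m u = algebraMap ℂ _ ((-N) u) := by
    intro u
    refine LinearMap.ext fun p => ?_
    ext
    · simp [m, muOp, Module.algebraMap_end_apply, hu_conj]
    · simp [m, muOp, Module.algebraMap_end_apply, hconj_u]
  let F : CliffordAlgebra (-N) →ₐ[ℂ] Module.End ℂ (A × A) := CliffordAlgebra.lift (-N) ⟨m, hm⟩
  have hF : ∀ u, F (CliffordAlgebra.ι (-N) u) = m u := fun u => by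
    simp [F]
  -- the grading operator
  let J : Module.End ℂ (A × A) :=
    LinearMap.prod (LinearMap.fst ℂ A A) (-(LinearMap.snd ℂ A A))
  have hJm : ∀ u, J * m u = -(m u * J) := by
    intro u
    refine LinearMap.ext fun p => ?_
    ext <;> simp [J, m, muOp]
  have hJJ : J * J = 1 := by
    refine LinearMap.ext fun p => ?_
    ext <;> simp [J]
  have hinv : ∀ x, F (CliffordAlgebra.involute x) * J = J * F x := by
    intro x
    induction x using CliffordAlgebra.left_induction with
    | algebraMap c => simp [Algebra.commutes]
    | add x y hx hy => simp only [map_add, add_mul, mul_add, hx, hy]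
    | ι_mul x w hx =>
      rw [map_mul, map_mul, map_mul, mul_assoc, hx, CliffordAlgebra.involute_ι, map_neg, hF,
        ← mul_assoc, ← mul_assoc, hJm]
      exact LinearMap.ext fun p => rfl
  have hker_inv : ∀ x, F x = 0 → F (CliffordAlgebra.involute x) = 0 := by
    intro x hx
    have h := hinv x
    rw [hx, mul_zero] at h
    have h2 := congrArg (· * J) h
    simpa [mul_assoc, hJJ] using h2
  have hdual : Function.Surjective ((-N).polarBilin) := by
    have hinj : Function.Injective ((-N).polarBilin) := by
      rw [injective_iff_map_eq_zero]
      intro x hx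
      refine hnondeg x fun y => ?_
      have := LinearMap.congr_fun hx y
      simpa [QuadraticMap.polar_neg] using this
    exact (LinearMap.injective_iff_surjective_of_finrank_eq_finrank
      (Subspace.dual_finrank_eq (K := ℂ) (V := A)).symm).1 hinj
  have hinj : Function.Injective F := by
    rw [injective_iff_map_eq_zero]
    intro x hx
    refine CliffHelp.eq_bot_of_contract (-N) (Module.finBasis ℂ A) (LinearMap.ker F.toLinearMap)
      ?_ ?_ x (by simpa using hx)
    · intro d x hx
      obtain ⟨v, rfl⟩ := hdual d
      have hx' : F x = 0 := by simpa using hx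
      simp [CliffHelp.contract_polar, hx', hker_inv x hx']
    · intro c hc
      have h : algebraMap ℂ (Module.End ℂ (A × A)) c = 0 := by simpa using hc
      exact (map_eq_zero_iff _ (algebraMap ℂ (Module.End ℂ (A × A))).injective).1 h
  obtain ⟨hfin, hrank⟩ := CliffHelp.finrank_clifford (-N) hdim
  have hbij : Function.Bijective F := by
    refine ⟨hinj, ?_⟩
    refine (LinearMap.injective_iff_surjective_of_finrank_eq_finrank
      (f := F.toLinearMap) ?_).1 hinj
    rw [hrank, Module.finrank_linearMap, Module.finrank_prod, hdim]
  refine ⟨AlgEquiv.ofBijective F hbij, fun u => hF u, ?_⟩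
  intro g hg
  have : (g : CliffordAlgebra (-N) →ₐ[ℂ] Module.End ℂ (A × A)) = F := by
    apply CliffordAlgebra.hom_ext
    ext1 u
    exact (hg u).trans (hF u).symm
  ext1 x
  exact DFunLike.congr_fun this x
end

section
/- Let O be an octonion algebra over ℂ and let V₉ = ℂ ⊕ O carry the quadratic form N'(r,u) = r² + N(u). The ℂ-linear map κ : V₉ → End_ℂ(O²) ⊗_ℝ ℂ sending (r,u) to [[r, L_u],[L_{ū}, −r]] ⊗ i satisfies κ(r,u)·κ(r,u) = −N'(r,u)·1, and hence extends to an isomorphism of associative algebras Cliff(V₉, N') ≅ End_ℂ(O²) ⊗_ℝ ℂ. -/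
open QuadraticMap TensorProduct

variable {A : Type*} [NonAssocRing A] [Module ℂ A]
  [SMulCommClass ℂ A A] [IsScalarTower ℂ A A]
  [Module ℝ A] [IsScalarTower ℝ ℂ A]

/-- The operator `[[r, L_u], [L_{ū}, −r]]` on `O ⊕ O` associated to `(r, u) ∈ ℂ ⊕ O`. -/
def kappaOp (conjO : A →ₗ[ℂ] A) (v : ℂ × A) : Module.End ℂ (A × A) :=
  LinearMap.prod
    (v.1 • LinearMap.fst ℂ A A + (LinearMap.mulLeft ℂ v.2).comp (LinearMap.snd ℂ A A))
    ((LinearMap.mulLeft ℂ (conjO v.2)).comp (LinearMap.fst ℂ A A) - v.1 • LinearMap.snd ℂ A A)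

/-- Joint eigenvectors with distinct systems of eigenvalues are linearly independent. -/
theorem li_of_joint_eigen {M ι κ : Type*} [AddCommGroup M] [Module ℂ M]
    (f : κ → M →ₗ[ℂ] M) (v : ι → M) (χ : ι → κ → ℂ)
    (hf : ∀ i k, f k (v i) = χ i k • v i) (hχ : Function.Injective χ)
    (hv : ∀ i, v i ≠ 0) : LinearIndependent ℂ v := by
  classical
  rw [linearIndependent_iff']
  intro s
  induction s using Finset.induction_on with
  | empty => simp
  | insert i s his ih =>
    intro a ha
    have key : ∀ j ∈ s, a j = 0 := by
      intro j hj
      have hij : i ≠ j := fun h => his (h ▸ hj)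
      obtain ⟨k, hk⟩ : ∃ k, χ i k ≠ χ j k := by
        by_contra! h
        exact hij (hχ (funext h))
      have h1 : ∑ l ∈ insert i s, (a l * (χ l k - χ i k)) • v l = 0 := by
        have h2 := congrArg (f k) ha
        have h3 := congrArg (fun x => χ i k • x) ha
        simp only [map_sum, map_smul, hf, Finset.smul_sum, smul_zero, map_zero] at h2 h3
        rw [← sub_zero (0 : M)]
        nth_rewrite 1 [← h2]
        rw [← h3, ← Finset.sum_sub_distrib]
        refine Finset.sum_congr rfl fun l _ => ?_
        simp only [smul_smul, ← sub_smul]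
        congr 1; ring
      rw [Finset.sum_insert his] at h1
      simp only [sub_self, mul_zero, zero_smul, zero_add] at h1
      have := ih _ h1 j hj
      rcases mul_eq_zero.1 this with h | h
      · exact h
      · exact absurd (sub_eq_zero.1 h).symm hk
    intro l hl
    rcases Finset.mem_insert.1 hl with rfl | hl
    · rw [Finset.sum_insert his, Finset.sum_eq_zero (fun j hj => by rw [key j hj, zero_smul]),
        add_zero] at ha
      exact (smul_eq_zero.1 ha).resolve_right (hv _)
    · exact key l hl

/-- Ordered monomials in a family of elements. -/
def cliffMono {R : Type*} [Ring R] {n : ℕ} (E : Fin n → R) (S : Finset (Fin n)) : R :=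
  ((List.finRange n).map (fun i => if i ∈ S then E i else 1)).prod

theorem list_semicomm {R ι : Type*} [Ring R] [Algebra ℂ R] (x : R) (g : ι → R) (s : ι → ℂ)
    (h : ∀ i, x * g i = s i • (g i * x)) (l : List ι) :
    x * (l.map g).prod = (l.map s).prod • ((l.map g).prod * x) := by
  induction l with
  | nil => simp
  | cons i l ih =>
    simp only [List.map_cons, List.prod_cons]
    rw [← mul_assoc, h, smul_mul_assoc, mul_assoc, ih, mul_smul_comm, smul_smul, mul_assoc]

theorem list_eigen {R ι : Type*} [Ring R] [Algebra ℂ R] (σ : R →ₐ[ℂ] R) (g : ι → R) (s : ι → ℂ)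
    (h : ∀ i, σ (g i) = s i • g i) (l : List ι) :
    σ (l.map g).prod = (l.map s).prod • (l.map g).prod := by
  induction l with
  | nil => simp
  | cons i l ih =>
    simp only [List.map_cons, List.prod_cons, map_mul, ih, h, smul_mul_smul_comm]

theorem list_finRange_prod {n : ℕ} (s : Fin n → ℂ) :
    ((List.finRange n).map s).prod = ∏ i, s i := by
  rw [← List.ofFn_eq_map, List.prod_ofFn]

theorem cliffMono_li {R : Type*} [Ring R] [Algebra ℂ R] [Nontrivial R] {n : ℕ} (E : Fin n → R)
    (c : Fin n → ℂ) (hc : ∀ i, c i ≠ 0) (hsq : ∀ i, E i * E i = c i • 1)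
    (hanti : ∀ i j, i ≠ j → E i * E j = - (E j * E i))
    (σ : R →ₐ[ℂ] R) (hσ : ∀ i, σ (E i) = - E i) :
    LinearIndependent ℂ (cliffMono E) := by
  classical
  let sg : Finset (Fin n) → Fin n → Fin n → ℂ := fun S j i => if i ∈ S ∧ i ≠ j then -1 else 1
  let s0 : Finset (Fin n) → Fin n → ℂ := fun S i => if i ∈ S then -1 else 1
  have hcomm : ∀ S j, E j * cliffMono E S = (∏ i, sg S j i) • (cliffMono E S * E j) := by
    intro S j
    rw [← list_finRange_prod]
    apply list_semicomm
    intro i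
    by_cases hi : i ∈ S
    · by_cases hij : i = j
      · simp [sg, hij]
      · simp [sg, hi, hij, hanti j i (Ne.symm hij)]
    · simp [sg, hi]
  have hsig : ∀ S, σ (cliffMono E S) = (∏ i, s0 S i) • cliffMono E S := by
    intro S
    rw [← list_finRange_prod]
    apply list_eigen
    intro i
    by_cases hi : i ∈ S
    · simp [s0, hi, hσ]
    · simp [s0, hi]
  have hrel : ∀ S j, (∏ i, s0 S i) = (∏ i, sg S j i) * s0 S j := by
    intro S j
    have : ∀ i, s0 S i = sg S j i * (if i = j then s0 S j else 1) := by
      intro i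
      by_cases hij : i = j
      · simp [sg, hij]
      · simp [sg, s0, hij]
    rw [Finset.prod_congr rfl (fun i _ => this i), Finset.prod_mul_distrib]
    simp
  let f : Option (Fin n) → R →ₗ[ℂ] R := fun k => match k with
    | none => σ.toLinearMap
    | some j => (LinearMap.mulRight ℂ (E j)).comp (LinearMap.mulLeft ℂ (E j))
  let χ : Finset (Fin n) → Option (Fin n) → ℂ := fun S k => match k with
    | none => ∏ i, s0 S i
    | some j => (∏ i, sg S j i) * c j
  have hs0 : ∀ S i, s0 S i ≠ 0 := by
    intro S i; simp only [s0]; split_ifs <;> simp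
  have hsgne : ∀ S j, (∏ i, sg S j i) ≠ 0 := by
    intro S j
    refine Finset.prod_ne_zero_iff.2 fun i _ => ?_
    simp only [sg]; split_ifs <;> simp
  refine li_of_joint_eigen f (cliffMono E) χ ?_ ?_ ?_
  · rintro S (_ | j)
    · exact hsig S
    · simp only [f, χ, LinearMap.comp_apply, LinearMap.mulLeft_apply, LinearMap.mulRight_apply]
      rw [hcomm, smul_mul_assoc, mul_assoc, hsq, mul_smul_comm, mul_one, smul_smul]
  · intro S T h
    ext j
    have h1 : (∏ i, s0 S i) = ∏ i, s0 T i := congrFun h none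
    have h2 : (∏ i, sg S j i) * c j = (∏ i, sg T j i) * c j := congrFun h (some j)
    have h3 := mul_right_cancel₀ (hc j) h2
    rw [hrel S j, hrel T j, h3] at h1
    have h4 := mul_left_cancel₀ (hsgne T j) h1
    by_cases hS : j ∈ S <;> by_cases hT : j ∈ T <;> simp [s0, hS, hT] at h4 ⊢
    · norm_num at h4
    · norm_num at h4
  · intro S
    have hu : IsUnit (cliffMono E S) := by
      unfold cliffMono
      apply List.prod_isUnit
      intro m hm
      obtain ⟨i, -, rfl⟩ := List.mem_map.1 hm
      split_ifs
      · refine ⟨⟨E i, (c i)⁻¹ • E i, ?_, ?_⟩, rfl⟩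
        · rw [mul_smul_comm, hsq, smul_smul, inv_mul_cancel₀ (hc i), one_smul]
        · rw [smul_mul_assoc, hsq, smul_smul, inv_mul_cancel₀ (hc i), one_smul]
      · exact isUnit_one
    exact hu.ne_zero

theorem clifford_finrank {V : Type*} [AddCommGroup V] [Module ℂ V] (Q : QuadraticForm ℂ V)
    {n : ℕ} (b : Module.Basis (Fin n) ℂ V) :
    Module.Finite ℂ (CliffordAlgebra Q) ∧ Module.finrank ℂ (CliffordAlgebra Q) = 2 ^ n := by
  let b' := b.ExteriorAlgebra.map (CliffordAlgebra.equivExterior Q).symm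
  exact ⟨Module.Finite.of_basis b', by simp [Module.finrank_eq_card_basis b']⟩

theorem clifford_hom_bijective {V R : Type*} [AddCommGroup V] [Module ℂ V] [FiniteDimensional ℂ V]
    (Q : QuadraticForm ℂ V) (hQ : ∀ x : V, (∀ y : V, polar Q x y = 0) → x = 0)
    [Ring R] [Algebra ℂ R] [Nontrivial R] [FiniteDimensional ℂ R]
    (hR : Module.finrank ℂ R = 2 ^ Module.finrank ℂ V)
    (F : CliffordAlgebra Q →ₐ[ℂ] R) (σ : R →ₐ[ℂ] R)
    (hσ : ∀ v, σ (F (CliffordAlgebra.ι Q v)) = - F (CliffordAlgebra.ι Q v)) :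
    Function.Bijective F := by
  obtain ⟨b, hb⟩ := LinearMap.BilinForm.exists_orthogonal_basis
    (QuadraticForm.associated_isSymm ℂ Q)
  obtain ⟨hfin, hrk⟩ := clifford_finrank Q b
  have hsep : (associated (R := ℂ) Q).SeparatingLeft := by
    intro x hx
    apply hQ
    intro y
    have := two_nsmul_associated ℂ Q
    have h := congrArg (fun B => B x y) this
    simp only [LinearMap.smul_apply, hx y, smul_zero] at h
    exact h.symm
  have hne := hb.not_isOrtho_basis_self_of_separatingLeft hsep
  have hli : LinearIndependent ℂ (cliffMono (fun i => F (CliffordAlgebra.ι Q (b i)))) := by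
    refine cliffMono_li _ (fun i => Q (b i)) ?_ ?_ ?_ σ (fun i => hσ _)
    · intro i
      have := hne i
      rwa [associated_eq_self_apply] at this
    · intro i
      rw [← map_mul, CliffordAlgebra.ι_sq_scalar, AlgHom.commutes, Algebra.algebraMap_eq_smul_one]
    · intro i j hij
      rw [← map_mul F, ← map_mul F, eq_neg_iff_add_eq_zero, ← map_add F,
        CliffordAlgebra.ι_mul_ι_add_swap, AlgHom.commutes]
      have h1 : associated (R := ℂ) Q (b i) (b j) = 0 := hb hij
      have := congrArg (fun B => B (b i) (b j)) (two_nsmul_associated ℂ Q)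
      simp only [LinearMap.smul_apply, h1, smul_zero] at this
      have h2 : polar Q (b i) (b j) = 0 := this.symm
      rw [h2, map_zero]
  have hspan := hli.span_eq_top_of_card_eq_finrank (by simp [hR])
  have hsurj : Function.Surjective F := by
    have : LinearMap.range F.toLinearMap = ⊤ := by
      rw [eq_top_iff, ← hspan, Submodule.span_le]
      rintro _ ⟨S, rfl⟩
      refine ⟨cliffMono (fun i => CliffordAlgebra.ι Q (b i)) S, ?_⟩
      simp only [cliffMono, AlgHom.toLinearMap_apply, map_list_prod, List.map_map]
      congr 2
      funext i
      by_cases h : i ∈ S <;> simp [h]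
    exact LinearMap.range_eq_top.1 this
  refine ⟨?_, hsurj⟩
  exact (LinearMap.injective_iff_surjective_of_finrank_eq_finrank (f := F.toLinearMap)
    (by rw [hrk, hR])).2 hsurj


section comp

set_option linter.unusedSectionVars false

variable {B : Type*} [NonAssocRing B] [Module ℂ B]
  [SMulCommClass ℂ B B] [IsScalarTower ℂ B B]

theorem comp_polar_left (N : QuadraticForm ℂ B) (hmul : ∀ x y : B, N (x * y) = N x * N y)
    (x y z : B) : polar N (x * y) (x * z) = N x * polar N y z := by
  simp only [polar, ← mul_add, hmul]; ring

theorem comp_polar_exch (N : QuadraticForm ℂ B) (hmul : ∀ x y : B, N (x * y) = N x * N y)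
    (x w y z : B) :
    polar N (x * y) (w * z) + polar N (w * y) (x * z) = polar N x w * polar N y z := by
  have h := comp_polar_left N hmul (x + w) y z
  rw [add_mul, add_mul, polar_add_left, polar_add_right, polar_add_right,
    comp_polar_left N hmul, comp_polar_left N hmul, QuadraticMap.map_add N x w] at h
  linear_combination h

theorem comp_conj_mul (N : QuadraticForm ℂ B) (hmul : ∀ x y : B, N (x * y) = N x * N y)
    (hnondeg : ∀ x : B, (∀ y : B, polar N x y = 0) → x = 0)
    (cj : B →ₗ[ℂ] B) (hconj : ∀ x : B, cj x = polar N x 1 • (1 : B) - x) (x y : B) :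
    cj x * (x * y) = N x • y := by
  have adj : ∀ y z, polar N (cj x * y) z = polar N y (x * z) := by
    intro y z
    have h := comp_polar_exch N hmul x 1 y z
    rw [one_mul, one_mul] at h
    rw [hconj, sub_mul, smul_mul_assoc, one_mul, polar_sub_left, polar_smul_left, smul_eq_mul]
    linear_combination -h
  rw [← sub_eq_zero]
  apply hnondeg
  intro z
  rw [polar_sub_left, adj, polar_smul_left, comp_polar_left N hmul, smul_eq_mul, sub_self]

theorem comp_mul_conj (N : QuadraticForm ℂ B) (hmul : ∀ x y : B, N (x * y) = N x * N y)
    (hnondeg : ∀ x : B, (∀ y : B, polar N x y = 0) → x = 0)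
    (cj : B →ₗ[ℂ] B) (hconj : ∀ x : B, cj x = polar N x 1 • (1 : B) - x) (x y : B) :
    x * (cj x * y) = N x • y := by
  rw [← comp_conj_mul N hmul hnondeg cj hconj x y, hconj]
  simp only [sub_mul, mul_sub, smul_mul_assoc, one_mul, mul_smul_comm]

theorem kappaOp_sq' (N : QuadraticForm ℂ B) (hmul : ∀ x y : B, N (x * y) = N x * N y)
    (hnondeg : ∀ x : B, (∀ y : B, polar N x y = 0) → x = 0)
    (cj : B →ₗ[ℂ] B) (hconj : ∀ x : B, cj x = polar N x 1 • (1 : B) - x) (v : ℂ × B) :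
    kappaOp cj v * kappaOp cj v = (QuadraticMap.prod QuadraticMap.sq N v) • 1 := by
  obtain ⟨r, u⟩ := v
  apply LinearMap.ext
  rintro ⟨x, y⟩
  have h1 := comp_conj_mul N hmul hnondeg cj hconj u y
  have h2 := comp_mul_conj N hmul hnondeg cj hconj u x
  ext
  · simp [kappaOp, mul_sub, h2, smul_smul, add_smul, mul_smul_comm]
  · simp [kappaOp, mul_add, h1, smul_smul, add_smul, smul_sub, mul_smul_comm]
    abel

end comp

/-- `V₉ = ℂ ⊕ O` with the quadratic form `N'(r,u) = r² + N(u)`; the map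
`κ(r,u) = [[r, L_u], [L_{ū}, −r]] ⊗ i` into `End_ℂ(O²) ⊗_ℝ ℂ` satisfies
`κ(v)·κ(v) = −N'(v)·1` and hence extends to an isomorphism of associative algebras
`Cliff(V₉, N') ≅ End_ℂ(O²) ⊗_ℝ ℂ` (Clifford convention `v·v = −N'(v)`). -/
theorem clifford9_iso_end_tensor_complex (N : QuadraticForm ℂ A)
    (hmul : ∀ x y : A, N (x * y) = N x * N y)
    (hnondeg : ∀ x : A, (∀ y : A, polar N x y = 0) → x = 0)
    (hdim : Module.finrank ℂ A = 8)
    (conjO : A →ₗ[ℂ] A)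
    (hconj : ∀ x : A, conjO x = polar N x 1 • (1 : A) - x) :
    (∀ v : ℂ × A,
        ((kappaOp conjO v ⊗ₜ[ℝ] Complex.I) * (kappaOp conjO v ⊗ₜ[ℝ] Complex.I)
            : Module.End ℂ (A × A) ⊗[ℝ] ℂ)
          = (-(QuadraticMap.prod QuadraticMap.sq N v)) • 1) ∧
    ∃ f : CliffordAlgebra (-(QuadraticMap.prod QuadraticMap.sq N))
            ≃ₐ[ℂ] (Module.End ℂ (A × A) ⊗[ℝ] ℂ),
      ∀ v : ℂ × A,
        f (CliffordAlgebra.ι (-(QuadraticMap.prod QuadraticMap.sq N)) v)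
          = kappaOp conjO v ⊗ₜ[ℝ] Complex.I := by
  have : FiniteDimensional ℂ A := FiniteDimensional.of_finrank_pos (by omega)
  have : Nontrivial A := Module.nontrivial_of_finrank_pos (R := ℂ) (by omega)
  have hsq : ∀ v : ℂ × A,
        ((kappaOp conjO v ⊗ₜ[ℝ] Complex.I) * (kappaOp conjO v ⊗ₜ[ℝ] Complex.I)
            : Module.End ℂ (A × A) ⊗[ℝ] ℂ)
          = (-(QuadraticMap.prod QuadraticMap.sq N v)) • 1 := by
    intro v
    rw [Algebra.TensorProduct.tmul_mul_tmul, kappaOp_sq' N hmul hnondeg conjO hconj,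
      Complex.I_mul_I, tmul_neg, ← smul_tmul', ← Algebra.TensorProduct.one_def]
    exact (neg_smul (QuadraticMap.prod QuadraticMap.sq N v)
      (1 : Module.End ℂ (A × A) ⊗[ℝ] ℂ)).symm
  refine ⟨hsq, ?_⟩
  let κ : ℂ × A →ₗ[ℂ] Module.End ℂ (A × A) ⊗[ℝ] ℂ :=
    { toFun := fun v => kappaOp conjO v ⊗ₜ[ℝ] Complex.I
      map_add' := by
        intro v w
        rw [← add_tmul]
        congr 1
        apply LinearMap.ext
        rintro ⟨x, y⟩
        ext
        · simp [kappaOp, add_smul, add_mul]; abel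
        · simp [kappaOp, add_smul, add_mul]; abel
      map_smul' := by
        intro c v
        rw [RingHom.id_apply, smul_tmul']
        congr 1
        apply LinearMap.ext
        rintro ⟨x, y⟩
        ext
        · simp [kappaOp, smul_smul, smul_add, smul_mul_assoc]
        · simp [kappaOp, smul_smul, smul_sub, smul_mul_assoc] }
  let F : CliffordAlgebra (-(QuadraticMap.prod QuadraticMap.sq N)) →ₐ[ℂ]
      (Module.End ℂ (A × A) ⊗[ℝ] ℂ) :=
    CliffordAlgebra.lift _ ⟨κ, fun v => by
      rw [Algebra.algebraMap_eq_smul_one]; exact hsq v⟩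
  have hF : ∀ v, F (CliffordAlgebra.ι _ v) = kappaOp conjO v ⊗ₜ[ℝ] Complex.I := fun v =>
    CliffordAlgebra.lift_ι_apply _ _ v
  let σ : (Module.End ℂ (A × A) ⊗[ℝ] ℂ) →ₐ[ℂ] (Module.End ℂ (A × A) ⊗[ℝ] ℂ) :=
    Algebra.TensorProduct.map (AlgHom.id ℂ _) Complex.conjAe.toAlgHom
  let b := (Module.finBasis ℂ (Module.End ℂ (A × A))).tensorProduct Complex.basisOneI
  have : FiniteDimensional ℂ (Module.End ℂ (A × A) ⊗[ℝ] ℂ) := Module.Finite.of_basis b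
  have hrk : Module.finrank ℂ (Module.End ℂ (A × A) ⊗[ℝ] ℂ) = 2 ^ Module.finrank ℂ (ℂ × A) := by
    rw [Module.finrank_eq_card_basis b]
    simp [hdim, Module.finrank_linearMap]
  have : Nontrivial (Module.End ℂ (A × A) ⊗[ℝ] ℂ) :=
    Module.nontrivial_of_finrank_pos (R := ℂ) (by rw [hrk]; positivity)
  have hbij : Function.Bijective F := by
    refine clifford_hom_bijective (R := Module.End ℂ (A × A) ⊗[ℝ] ℂ) _ ?_ hrk F σ ?_
    · rintro ⟨r, u⟩ h
      have hp : ∀ y : ℂ × A, polar (QuadraticMap.prod QuadraticMap.sq N) (r, u) y = 0 := by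
        intro y
        have := h y
        rw [FunLike.coe_neg, polar_neg, neg_eq_zero] at this
        exact this
      have hr : r = 0 := by
        have := hp (1, 0)
        rw [polar_prod] at this
        simp [polar] at this
        linear_combination this / 2
      have hu : u = 0 := by
        apply hnondeg
        intro y
        have := hp (0, y)
        rw [polar_prod] at this
        simpa [polar] using this
      rw [hr, hu]; rfl
    · intro v
      rw [hF]
      simp [σ, tmul_neg]
  exact ⟨AlgEquiv.ofBijective F hbij, fun v => hF v⟩
end

section
/- Let (r,u) ∈ ℂ × O with r² + uū = 1, and set G = [[1,0,0],[0,r,−u],[0,ū,r]] ∈ Herm-type matrices over O (entries scalars and octonions). Then G is invertible with G⁻¹ = [[1,0,0],[0,r,u],[0,−ū,r]], and for every A ∈ Herm(3,O) the map A ↦ G A G⁻¹ preserves the Jordan product: (GAG⁻¹)∘(GBG⁻¹) = G(A∘B)G⁻¹ for all A, B ∈ Herm(3,O). -/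
open QuadraticMap

variable {A : Type*} [NonAssocRing A] [Module ℂ A]
  [SMulCommClass ℂ A A] [IsScalarTower ℂ A A]

/-- The `ℂ`-subspace of hermitian `3 × 3` matrices over the (complex) octonions. -/
def HermSub (conjO : A →ₗ[ℂ] A) : Submodule ℂ (Matrix (Fin 3) (Fin 3) A) where
  carrier := {M | ∀ i j, M j i = conjO (M i j)}
  add_mem' := by
    intro X Y hX hY i j
    simp [Matrix.add_apply, hX i j, hY i j]
  zero_mem' := by intro i j; simp
  smul_mem' := by
    intro c X hX i j
    simp [Matrix.smul_apply, hX i j]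

/-- The Jordan product `A ∘ B = ½(AB + BA)`. -/
noncomputable def jord (X Y : Matrix (Fin 3) (Fin 3) A) : Matrix (Fin 3) (Fin 3) A :=
  (2⁻¹ : ℂ) • (X * Y + Y * X)


set_option linter.unusedSimpArgs false
set_option linter.unusedSectionVars false

/-- Identities of a composition algebra. -/
structure CompFacts (N : QuadraticForm ℂ A) (c : A →ₗ[ℂ] A) : Prop where
  cc : ∀ x, c (c x) = x
  cm : ∀ x y, c (x * y) = c y * c x
  c1 : c 1 = 1
  nm : ∀ x y, N (x * y) = N x * N y
  nc : ∀ x, N (c x) = N x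
  bc : ∀ x y, polar N (c x) (c y) = polar N x y
  mr : ∀ x, x * c x = N x • (1 : A)
  ml : ∀ x, c x * x = N x • (1 : A)
  l1 : ∀ x y z, c x * (y * z) + c y * (x * z) = polar N x y • z
  l2 : ∀ x y z, x * (c y * z) + y * (c x * z) = polar N x y • z
  r1 : ∀ x y z, (z * x) * c y + (z * y) * c x = polar N x y • z
  r2 : ∀ x y z, (z * c x) * y + (z * c y) * x = polar N x y • z
  tr : ∀ x y, x * c y + y * c x = polar N x y • (1 : A)
  tl : ∀ x y, c x * y + c y * x = polar N x y • (1 : A)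
  aL : ∀ x y z, polar N (x * y) z = polar N y (c x * z)
  aR : ∀ x y z, polar N (x * y) z = polar N x (z * c y)
  mo : ∀ u x y, (u * c y) * (x * u) = polar N u (c x * y) • u - N u • (c x * y)
  sc : ∀ x, c x = x → ∃ a : ℂ, x = a • (1 : A)

theorem compFacts_of (N : QuadraticForm ℂ A)
    (hmul : ∀ x y : A, N (x * y) = N x * N y)
    (hnondeg : ∀ x : A, (∀ y : A, polar N x y = 0) → x = 0)
    (hdim : Module.finrank ℂ A = 8)
    (c : A →ₗ[ℂ] A)
    (hconj : ∀ x : A, c x = polar N x 1 • (1 : A) - x) : CompFacts N c := by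
  have pa : ∀ x y z : A, polar N (x + y) z = polar N x z + polar N y z :=
    fun x y z => polar_add_left N x y z
  have pa' : ∀ x y z : A, polar N z (x + y) = polar N z x + polar N z y :=
    fun x y z => polar_add_right N z x y
  have ps : ∀ (a : ℂ) (x z : A), polar N (a • x) z = a * polar N x z :=
    fun a x z => by simp [polar_smul_left]
  have ps' : ∀ (a : ℂ) (x z : A), polar N z (a • x) = a * polar N z x :=
    fun a x z => by simp [polar_smul_right]
  have pd : ∀ x y z : A, polar N (x - y) z = polar N x z - polar N y z :=
    fun x y z => polar_sub_left N x y z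
  have pd' : ∀ x y z : A, polar N z (x - y) = polar N z x - polar N z y :=
    fun x y z => polar_sub_right N z x y
  have pc : ∀ x y : A, polar N x y = polar N y x := fun x y => polar_comm N x y
  have pself : ∀ x : A, polar N x x = 2 * N x := fun x => by
    simp [polar_self]
  have nd : ∀ x y : A, (∀ w, polar N x w = polar N y w) → x = y := by
    intro x y h
    refine sub_eq_zero.mp (hnondeg _ fun w => ?_)
    rw [pd, h, sub_self]
  have hN1 : N 1 = 1 := by
    by_contra h1
    have hz : ∀ x, N x = 0 := by
      intro x
      have := hmul x 1
      rw [mul_one] at this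
      by_contra hx
      exact h1 (mul_left_cancel₀ hx (by rw [mul_one, ← this]))
    have hall : ∀ x : A, x = 0 := fun x => hnondeg x fun y => by simp [polar, hz]
    have : Subsingleton A := ⟨fun x y => by rw [hall x, hall y]⟩
    rw [Module.finrank_zero_of_subsingleton] at hdim
    omega
  have h11 : polar N (1 : A) 1 = 2 := by rw [pself, hN1, mul_one]
  have q1 : ∀ x y z : A, polar N (x * y) (x * z) = N x * polar N y z := by
    intro x y z
    simp only [polar, ← mul_add, hmul]; ring
  have q2 : ∀ x y z w : A, polar N (x * y) (w * z) + polar N (w * y) (x * z)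
      = polar N x w * polar N y z := by
    intro x y z w
    have h := q1 (x + w) y z
    have e : N (x + w) = N x + N w + polar N x w := by simp [polar]
    rw [add_mul, add_mul, pa, pa', pa', q1, q1, e] at h
    linear_combination h
  have aL : ∀ x y z, polar N (x * y) z = polar N y (c x * z) := by
    intro x y z
    have h := q2 x y z 1
    rw [one_mul, one_mul] at h
    rw [hconj, sub_mul, smul_mul_assoc, one_mul, pd', ps']
    linear_combination h
  have aR : ∀ x y z, polar N (x * y) z = polar N x (z * c y) := by
    intro x y z
    have h := q2 x y 1 z
    rw [mul_one, mul_one] at h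
    rw [hconj, mul_sub, mul_smul_comm, mul_one, pd', ps', pc x (z * y)]
    linear_combination h
  have ct : ∀ x, polar N (c x) 1 = polar N x 1 := by
    intro x
    rw [hconj, pd, ps, h11]; ring
  have cc : ∀ x, c (c x) = x := by
    intro x
    rw [hconj (c x), ct, hconj x]; abel
  have bc : ∀ x y, polar N (c x) (c y) = polar N x y := by
    intro x y
    rw [hconj x, hconj y, pd, pd', pd', ps, ps, ps', ps', h11, pc 1 y]; ring
  have bc' : ∀ x y, polar N (c x) y = polar N x (c y) := by
    intro x y
    rw [← bc x, cc]
  have cm : ∀ x y, c (x * y) = c y * c x := by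
    intro x y
    apply nd
    intro w
    have e1 : polar N (y * w) (c x) = polar N y (c x * c w) := aR _ _ _
    rw [bc', aL, ← e1, aL, pc]
  have nc : ∀ x, N (c x) = N x := by
    intro x
    have h := bc x x
    rw [pself, pself] at h
    exact mul_left_cancel₀ two_ne_zero h
  have c1 : c 1 = 1 := by
    rw [hconj, h11, two_smul]; abel
  have l1 : ∀ x y z, c x * (y * z) + c y * (x * z) = polar N x y • z := by
    intro x y z
    apply nd
    intro w
    have e1 : polar N (c x * (y * z)) w = polar N (y * z) (x * w) := by rw [aL, cc]
    have e2 : polar N (c y * (x * z)) w = polar N (x * z) (y * w) := by rw [aL, cc]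
    rw [pa, ps, e1, e2, ← q2, add_comm]
  have l2 : ∀ x y z, x * (c y * z) + y * (c x * z) = polar N x y • z := by
    intro x y z
    have h := l1 (c x) (c y) z
    rwa [cc, cc, bc] at h
  have r1 : ∀ x y z, (z * x) * c y + (z * y) * c x = polar N x y • z := by
    intro x y z
    have h := congrArg c (l2 x y (c z))
    rw [map_add, map_smul, cm, cm, cm, cm, cc, cc, cc] at h
    rw [← h, add_comm]
  have r2 : ∀ x y z, (z * c x) * y + (z * c y) * x = polar N x y • z := by
    intro x y z
    have h := r1 (c x) (c y) z
    rwa [cc, cc, bc] at h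
  have tr : ∀ x y, x * c y + y * c x = polar N x y • (1 : A) := by
    intro x y
    have h := r1 x y 1
    rwa [one_mul, one_mul] at h
  have tl : ∀ x y, c x * y + c y * x = polar N x y • (1 : A) := by
    intro x y
    have h := r2 x y 1
    rwa [one_mul, one_mul] at h
  have half : ∀ (x y : A) (a : ℂ), x + x = (2 * a) • y → x = a • y := by
    intro x y a h
    rw [mul_smul, ← two_smul ℂ x] at h
    exact smul_right_injective A (two_ne_zero (α := ℂ)) h
  have mr : ∀ x, x * c x = N x • (1 : A) := fun x => half _ _ _ (by rw [tr, pself])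
  have ml : ∀ x, c x * x = N x • (1 : A) := fun x => half _ _ _ (by rw [tl, pself])
  have lu : ∀ u z, u * (c u * z) = N u • z := fun u z => half _ _ _ (by rw [l2, pself])
  refine ⟨cc, cm, c1, hmul, nc, bc, mr, ml, l1, l2, r1, r2, tr, tl, aL, aR, ?_, ?_⟩
  · intro u x y
    apply nd
    intro w
    have e1 := q2 u (c y) (c u * c x) w
    have e2 : polar N ((u * c y) * (x * u)) w = polar N (u * c y) (w * (c u * c x)) := by
      rw [aR, cm]
    have e3 : polar N (c y) (c u * c x) = polar N u (c x * y) := by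
      rw [← aL, aR, cc]
    have e4 : polar N (w * c y) (c x) = polar N (c x * y) w := by
      rw [aR, cc, pc]
    rw [lu, ps', e3, e4] at e1
    rw [e2, pd, ps, ps]
    linear_combination e1
  · intro x hx
    have h := hconj x
    rw [hx] at h
    refine ⟨polar N x 1 / 2, half _ _ _ ?_⟩
    rw [mul_div_cancel₀ _ (two_ne_zero (α := ℂ))]
    nth_rewrite 1 [h]
    abel

/-- Hermitian matrices in coordinates. -/
def hm (c : A →ₗ[ℂ] A) (a b d : ℂ) (x y z : A) : Matrix (Fin 3) (Fin 3) A :=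
  !![a • 1, x, y; c x, b • 1, z; c y, c z, d • 1]

theorem exists_hm {N : QuadraticForm ℂ A} {c : A →ₗ[ℂ] A} (F : CompFacts N c)
    (X : Matrix (Fin 3) (Fin 3) A) (hX : X ∈ HermSub c) :
    ∃ (a b d : ℂ) (x y z : A), X = hm c a b d x y z := by
  have h : ∀ i j, X j i = c (X i j) := hX
  obtain ⟨a, ha⟩ := F.sc _ (h 0 0).symm
  obtain ⟨b, hb⟩ := F.sc _ (h 1 1).symm
  obtain ⟨d, hd⟩ := F.sc _ (h 2 2).symm
  refine ⟨a, b, d, X 0 1, X 0 2, X 1 2, ?_⟩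
  ext i j
  fin_cases i <;> fin_cases j <;> simp [hm, ha, hb, hd, ← h]

theorem hm_sq {N : QuadraticForm ℂ A} {c : A →ₗ[ℂ] A} (F : CompFacts N c)
    (a b d : ℂ) (x y z : A) :
    hm c a b d x y z * hm c a b d x y z =
      hm c (a ^ 2 + N x + N y) (b ^ 2 + N x + N z) (d ^ 2 + N y + N z)
        ((a + b) • x + y * c z) ((a + d) • y + x * z) ((b + d) • z + c x * y) := by
  ext i j
  fin_cases i <;> fin_cases j <;>
    simp [hm, Matrix.mul_apply, Fin.sum_univ_three, F.mr, F.ml, F.cm, F.cc] <;> module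

theorem hm_conj {N : QuadraticForm ℂ A} {c : A →ₗ[ℂ] A} (F : CompFacts N c)
    (r : ℂ) (u : A) (hr : r ^ 2 + N u = 1) (a b d : ℂ) (x y z : A) :
    (!![1, 0, 0; 0, r • 1, -u; 0, c u, r • 1] * hm c a b d x y z) *
      !![1, 0, 0; 0, r • 1, u; 0, -(c u), r • 1] =
      hm c a (r ^ 2 * b - r * polar N u z + N u * d) (N u * b + r * polar N u z + r ^ 2 * d)
        (r • x - y * c u) (x * u + r • y) (z + (r * (b - d) - polar N u z) • u) := by
  have s1 : z * c u = polar N u z • (1 : A) - u * c z := by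
    rw [← F.tr u z]; abel
  have s2 : c z * u = polar N u z • (1 : A) - c u * z := by
    rw [← F.tl u z]; abel
  have s3 : (u * c z) * u = polar N u z • u - N u • z := by
    have h := F.r2 z u u
    rw [F.mr, smul_mul_assoc, one_mul, polar_comm] at h
    rw [← h]; abel
  have s4 : (c u * z) * c u = polar N u z • c u - N u • c z := by
    have h := F.r1 z u (c u)
    rw [F.ml, smul_mul_assoc, one_mul, polar_comm] at h
    rw [← h]; abel
  have hn : N u = 1 - r ^ 2 := by rw [← hr]; ring
  ext i j
  fin_cases i <;> fin_cases j <;>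
    simp [hm, Matrix.mul_apply, Fin.sum_univ_three, F.mr, F.ml, F.cm, F.cc, add_mul, mul_add,
      sub_mul, mul_sub, s3, s4, hn, smul_mul_assoc, mul_smul_comm] <;> (try simp only [s1, s2]) <;> module

theorem hm_conj' {N : QuadraticForm ℂ A} {c : A →ₗ[ℂ] A} (F : CompFacts N c)
    (r : ℂ) (u : A) (hr : r ^ 2 + N u = 1) (a b d : ℂ) (x y z : A) :
    !![1, 0, 0; 0, r • 1, -u; 0, c u, r • 1] * (hm c a b d x y z *
      !![1, 0, 0; 0, r • 1, u; 0, -(c u), r • 1]) =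
      hm c a (r ^ 2 * b - r * polar N u z + N u * d) (N u * b + r * polar N u z + r ^ 2 * d)
        (r • x - y * c u) (x * u + r • y) (z + (r * (b - d) - polar N u z) • u) := by
  have s1 : z * c u = polar N u z • (1 : A) - u * c z := by
    rw [← F.tr u z]; abel
  have s2 : c z * u = polar N u z • (1 : A) - c u * z := by
    rw [← F.tl u z]; abel
  have s3 : u * (c z * u) = polar N u z • u - N u • z := by
    have h := F.l2 u z u
    rw [F.ml, mul_smul_comm, mul_one] at h
    rw [← h]; abel
  have s4 : c u * (z * c u) = polar N u z • c u - N u • c z := by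
    have h := F.l1 u z (c u)
    rw [F.mr, mul_smul_comm, mul_one] at h
    rw [← h]; abel
  have hn : N u = 1 - r ^ 2 := by rw [← hr]; ring
  ext i j
  fin_cases i <;> fin_cases j <;>
    simp [hm, Matrix.mul_apply, Fin.sum_univ_three, F.mr, F.ml, F.cm, F.cc, add_mul, mul_add,
      sub_mul, mul_sub, s3, s4, hn, smul_mul_assoc, mul_smul_comm] <;> (try simp only [s1, s2]) <;> module

theorem hm_conj_sq {N : QuadraticForm ℂ A} {c : A →ₗ[ℂ] A} (F : CompFacts N c)
    (r : ℂ) (u : A) (hr : r ^ 2 + N u = 1) (a b d : ℂ) (x y z : A) (X G Gi : Matrix (Fin 3) (Fin 3) A)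
    (hX : X = hm c a b d x y z)
    (hG : G = !![1, 0, 0; 0, r • 1, -u; 0, c u, r • 1])
    (hGi : Gi = !![1, 0, 0; 0, r • 1, u; 0, -(c u), r • 1]) :
    (G * X * Gi) * (G * X * Gi) = G * (X * X) * Gi := by
  have hn : N u = 1 - r ^ 2 := by rw [← hr]; ring
  have padd : ∀ v w : A, N (v + w) = N v + N w + polar N v w := fun v w => by simp [polar]
  have nsm : ∀ (k : ℂ) (v : A), N (k • v) = k ^ 2 * N v := fun k v => by
    rw [QuadraticMap.map_smul, smul_eq_mul]; ring
  have ps : ∀ (k : ℂ) (v w : A), polar N (k • v) w = k * polar N v w :=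
    fun k v w => by simp [polar_smul_left]
  have ps' : ∀ (k : ℂ) (v w : A), polar N w (k • v) = k * polar N w v :=
    fun k v w => by simp [polar_smul_right]
  have t0 : polar N (x * u) y = polar N u (c x * y) := F.aL x u y
  have t1 : polar N x (y * c u) = polar N u (c x * y) := by rw [← F.aR, t0]
  have nx : N (r • x - y * c u) = r ^ 2 * N x + N y * N u - r * polar N u (c x * y) := by
    have e : r • x - y * c u = r • x + (-1 : ℂ) • (y * c u) := by module
    rw [e, padd, nsm, nsm, ps, ps', t1, F.nm, F.nc]; ring
  have ny : N (x * u + r • y) = N x * N u + r ^ 2 * N y + r * polar N u (c x * y) := by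
    rw [padd, nsm, ps', t0, F.nm]
  have nz : ∀ k : ℂ, N (z + k • u) = N z + k ^ 2 * N u + k * polar N u z := by
    intro k
    rw [padd, nsm, ps', polar_comm N z u]
  have T : polar N u ((b + d) • z + c x * y) = (b + d) * polar N u z + polar N u (c x * y) := by
    rw [polar_add_right, ps']
  have f1 : (x * u) * c z = polar N u z • x - (x * z) * c u := by
    rw [← F.r1 u z x]; abel
  have f2 : (y * c u) * z = polar N u z • y - (y * c z) * u := by
    rw [← F.r2 u z y]; abel
  have half : ∀ v w : A, v + v = w + w → v = w := by
    intro v w h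
    rw [← two_smul ℂ, ← two_smul ℂ w] at h
    exact smul_right_injective A (two_ne_zero (α := ℂ)) h
  have f3 : (x * u) * c u = N u • x := by
    have h := F.r1 u u x
    rw [polar_self, two_smul, add_smul] at h
    exact half _ _ h
  have f4 : (y * c u) * u = N u • y := by
    have h := F.r2 u u y
    rw [polar_self, two_smul, add_smul] at h
    exact half _ _ h
  have f5 : c x * (x * u) = N x • u := by
    have h := F.l1 x x u
    rw [polar_self, two_smul, add_smul] at h
    exact half _ _ h
  have f6 : (u * c y) * y = N y • u := by
    have h := F.r2 y y u
    rw [polar_self, two_smul, add_smul] at h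
    exact half _ _ h
  have f7 := F.mo u x y
  rw [hX, hm_sq F, hG, hGi, hm_conj F r u hr, hm_conj F r u hr, hm_sq F, nx, ny, nz, T]
  congr 1
  · rw [hn]; ring
  · rw [hn]; ring
  · rw [hn]; ring
  · simp only [map_add, map_sub, map_smul, F.cm, F.cc, add_mul, mul_add, sub_mul, mul_sub,
      smul_mul_assoc, mul_smul_comm, f1, f3, hn]
    module
  · simp only [map_add, map_sub, map_smul, F.cm, F.cc, add_mul, mul_add, sub_mul, mul_sub,
      smul_mul_assoc, mul_smul_comm, f2, f4, hn]
    module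
  · simp only [map_add, map_sub, map_smul, F.cm, F.cc, add_mul, mul_add, sub_mul, mul_sub,
      smul_mul_assoc, mul_smul_comm, f5, f6, f7, hn]
    module

/-- For `(r,u)` with `r² + uū = 1` and `G = [[1,0,0],[0,r,−u],[0,ū,r]]`, the matrix `G`
is invertible with inverse `[[1,0,0],[0,r,u],[0,−ū,r]]`, the expression `G A G⁻¹` is
unambiguous on `Herm(3,O)`, and `A ↦ G A G⁻¹` preserves the Jordan product. -/
theorem G_conjugation_jordan_aut (N : QuadraticForm ℂ A)
    (hmul : ∀ x y : A, N (x * y) = N x * N y)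
    (hnondeg : ∀ x : A, (∀ y : A, polar N x y = 0) → x = 0)
    (hdim : Module.finrank ℂ A = 8)
    (conjO : A →ₗ[ℂ] A)
    (hconj : ∀ x : A, conjO x = polar N x 1 • (1 : A) - x)
    (r : ℂ) (u : A)
    (hru : (r ^ 2) • (1 : A) + u * conjO u = 1)
    (G Gi : Matrix (Fin 3) (Fin 3) A)
    (hG : G = !![1, 0, 0; 0, r • 1, -u; 0, conjO u, r • 1])
    (hGi : Gi = !![1, 0, 0; 0, r • 1, u; 0, -(conjO u), r • 1]) :
    G * Gi = 1 ∧ Gi * G = 1 ∧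
    (∀ X ∈ HermSub conjO, (G * X) * Gi = G * (X * Gi)) ∧
    (∀ X ∈ HermSub conjO, ∀ Y ∈ HermSub conjO,
      jord (G * X * Gi) (G * Y * Gi) = G * (jord X Y) * Gi) ∧
    (∀ X ∈ HermSub conjO, (G * X * Gi) * (G * X * Gi) = G * (X * X) * Gi) := by
  have F := compFacts_of N hmul hnondeg hdim conjO hconj
  have hone : (1 : A) ≠ 0 := by
    intro h
    have : Subsingleton A := ⟨fun x y => by rw [← mul_one x, ← mul_one y, h, mul_zero, mul_zero]⟩
    rw [Module.finrank_zero_of_subsingleton] at hdim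
    omega
  have hr : r ^ 2 + N u = 1 := by
    rw [F.mr, ← add_smul] at hru
    have h : (r ^ 2 + N u - 1) • (1 : A) = 0 := by rw [sub_smul, hru, one_smul, sub_self]
    exact sub_eq_zero.mp ((smul_eq_zero.mp h).resolve_right hone)
  have hn : N u = 1 - r ^ 2 := by rw [← hr]; ring
  have hsq : ∀ X ∈ HermSub conjO, (G * X * Gi) * (G * X * Gi) = G * (X * X) * Gi := by
    intro X hX
    obtain ⟨a, b, d, x, y, z, h⟩ := exists_hm F X hX
    exact hm_conj_sq F r u hr a b d x y z X G Gi h hG hGi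
  refine ⟨?_, ?_, ?_, ?_, hsq⟩
  · rw [hG, hGi]
    ext i j
    fin_cases i <;> fin_cases j <;>
      simp [Matrix.mul_apply, Fin.sum_univ_three, F.mr, F.ml, hn] <;> module
  · rw [hG, hGi]
    ext i j
    fin_cases i <;> fin_cases j <;>
      simp [Matrix.mul_apply, Fin.sum_univ_three, F.mr, F.ml, hn] <;> module
  · intro X hX
    obtain ⟨a, b, d, x, y, z, h⟩ := exists_hm F X hX
    rw [h, hG, hGi, hm_conj F r u hr, hm_conj' F r u hr]
  · intro X hX Y hY
    have h1 := hsq X hX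
    have h2 := hsq Y hY
    have h3 := hsq (X + Y) (add_mem hX hY)
    simp only [mul_add, add_mul, h1, h2] at h3
    unfold jord
    rw [Matrix.mul_smul, Matrix.smul_mul, mul_add, add_mul]
    congr 1
    have h4 := sub_eq_zero.mpr h3
    rw [← sub_eq_zero, ← h4]
    abel
end

section
/- For every A ∈ Herm(3,O) with Tr A = 0, A² = 0 and A ≠ 0, there exists an automorphism g of the Jordan algebra Herm(3,O) such that g(A) = [[i,1,0],[1,−i,0],[0,0,0]]. -/
open QuadraticMap

variable {A : Type*} [NonAssocRing A] [Module ℂ A]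
  [SMulCommClass ℂ A A] [IsScalarTower ℂ A A]

/-- The working data of a composition algebra: norm, conjugation, and their basic laws. -/
structure CompAlg (N : QuadraticForm ℂ A) (conjO : A →ₗ[ℂ] A) : Prop where
  hmul : ∀ x y : A, N (x * y) = N x * N y
  hnondeg : ∀ x : A, (∀ y : A, polar N x y = 0) → x = 0
  hone : N 1 = 1
  hconj : ∀ x : A, conjO x = polar N x 1 • (1 : A) - x

set_option linter.unusedSectionVars false
set_option linter.unusedSimpArgs false

namespace CompAlg

variable {N : QuadraticForm ℂ A} {conjO : A →ₗ[ℂ] A}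

theorem ext_polar (h : CompAlg N conjO) {x y : A} (hxy : ∀ z, polar N x z = polar N y z) :
    x = y := by
  rw [← sub_eq_zero]
  apply h.hnondeg
  intro z
  rw [polar_sub_left, hxy, sub_self]

theorem N_add (x y : A) : N (x + y) = N x + N y + polar N x y := by
  simp [polar]

theorem p_left (h : CompAlg N conjO) (x y z : A) :
    polar N (x * y) (x * z) = N x * polar N y z := by
  simp only [polar, ← mul_add, h.hmul]; ring

theorem p_right (h : CompAlg N conjO) (x y z : A) :
    polar N (x * z) (y * z) = polar N x y * N z := by
  simp only [polar, ← add_mul, h.hmul]; ring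

theorem p_four (h : CompAlg N conjO) (x w y z : A) :
    polar N (x * y) (w * z) + polar N (w * y) (x * z) = polar N x w * polar N y z := by
  have h1 := h.p_left (x + w) y z
  simp only [add_mul, polar_add_left, polar_add_right, h.p_left, N_add] at h1
  linear_combination h1

theorem polar_one_one (h : CompAlg N conjO) : polar N (1 : A) 1 = 2 := by
  rw [polar_self, h.hone]; simp

theorem adj_left (h : CompAlg N conjO) (x y z : A) :
    polar N (x * y) z = polar N y (conjO x * z) := by
  have h1 := h.p_four x 1 y z
  rw [h.hconj, sub_mul, polar_sub_right, smul_mul_assoc, polar_smul_right]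
  simp only [one_mul, smul_eq_mul] at *
  linear_combination h1

theorem adj_right (h : CompAlg N conjO) (x y z : A) :
    polar N (x * y) z = polar N x (z * conjO y) := by
  have h1 := h.p_four x z y 1
  rw [h.hconj, mul_sub, polar_sub_right, mul_smul_comm, polar_smul_right]
  simp only [mul_one, smul_eq_mul] at *
  rw [polar_comm N (z * y) x] at h1
  linear_combination h1

theorem conj_one (h : CompAlg N conjO) : conjO 1 = 1 := by
  rw [h.hconj, h.polar_one_one]
  rw [two_smul]; abel

theorem conj_conj (h : CompAlg N conjO) (x : A) : conjO (conjO x) = x := by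
  rw [h.hconj x, map_sub, map_smul, h.conj_one, h.hconj]; abel

theorem polar_conj (h : CompAlg N conjO) (x y : A) :
    polar N (conjO x) y = polar N x (conjO y) := by
  rw [h.hconj, h.hconj, polar_sub_left, polar_sub_right, polar_smul_left, polar_smul_right,
    polar_comm N 1 y]
  simp only [smul_eq_mul]; ring

theorem conj_mul (h : CompAlg N conjO) (x y : A) : conjO (x * y) = conjO y * conjO x := by
  apply h.ext_polar
  intro z
  have e1 : polar N (conjO (x * y)) z = polar N (x * y) (conjO z) := h.polar_conj _ _
  rw [e1, h.adj_right]
  have e2 := h.adj_right z x (conjO y)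
  have e3 := h.adj_left z (x) (conjO y)
  rw [polar_comm N (conjO y * conjO x), ← e2, e3]

theorem N_conj (h : CompAlg N conjO) (x : A) : N (conjO x) = N x := by
  have h1 := h.polar_conj x (conjO x)
  rw [h.conj_conj, polar_self, polar_self] at h1
  simpa using h1

theorem cancel_left (h : CompAlg N conjO) (x y : A) : conjO x * (x * y) = N x • y := by
  apply h.ext_polar
  intro z
  rw [h.adj_left, h.conj_conj, h.p_left, polar_smul_left, smul_eq_mul]

theorem cancel_left' (h : CompAlg N conjO) (x y : A) : x * (conjO x * y) = N x • y := by
  have := h.cancel_left (conjO x) y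
  rwa [h.conj_conj, h.N_conj] at this

theorem cancel_right (h : CompAlg N conjO) (x y : A) : (y * x) * conjO x = N x • y := by
  apply h.ext_polar
  intro z
  rw [h.adj_right, h.conj_conj, h.p_right, polar_smul_left, smul_eq_mul, mul_comm]

theorem cancel_right' (h : CompAlg N conjO) (x y : A) : (y * conjO x) * x = N x • y := by
  have := h.cancel_right (conjO x) y
  rwa [h.conj_conj, h.N_conj] at this

theorem mul_conj (h : CompAlg N conjO) (x : A) : x * conjO x = N x • (1 : A) := by
  simpa using h.cancel_right x 1

theorem conj_mul_self (h : CompAlg N conjO) (x : A) : conjO x * x = N x • (1 : A) := by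
  simpa using h.cancel_left x 1

theorem moufang_aux (h : CompAlg N conjO) (u x y z : A) :
    polar N ((u * x) * (y * u)) z
      = polar N u z * polar N (x * y) (conjO u) - N u * polar N (x * y) (conjO z) := by
  have h1 := h.p_four u z x (conjO u * conjO y)
  rw [h.cancel_left', polar_smul_right] at h1
  rw [h.adj_right (u * x), h.conj_mul, h.adj_right x y, h.adj_right x y]
  have h2 := h.adj_left z x (conjO y)
  rw [h2] at h1
  simp only [smul_eq_mul] at h1
  linear_combination h1

theorem moufang_mid (h : CompAlg N conjO) (u x y : A) :
    (u * x) * (y * u) = (u * (x * y)) * u := by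
  apply h.ext_polar
  intro z
  have := h.moufang_aux u (x * y) 1 z
  rw [h.moufang_aux, ← mul_one (x * y), ← this, one_mul]
  simp

theorem flex (h : CompAlg N conjO) (u x : A) : (u * x) * u = u * (x * u) := by
  have := h.moufang_mid u 1 x
  simpa using this.symm

theorem moufang_mid' (h : CompAlg N conjO) (u x y : A) :
    (u * x) * (y * u) = u * ((x * y) * u) := by
  rw [h.moufang_mid, h.flex]

theorem moufang_left (h : CompAlg N conjO) (u p q : A) :
    (u * (p * u)) * q = u * (p * (u * q)) := by
  apply h.ext_polar
  intro r
  rw [h.adj_right, h.adj_left, h.adj_right p u, h.adj_left u, h.adj_right p (u * q),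
    h.conj_mul, h.moufang_mid]

theorem moufang_right (h : CompAlg N conjO) (u p q : A) :
    q * (u * (p * u)) = ((q * u) * p) * u := by
  have := congrArg conjO (h.moufang_left (conjO u) (conjO p) (conjO q))
  simp only [h.conj_mul, h.conj_conj] at this
  rw [← this, h.flex]

/-- a self-conjugate element is a scalar -/
theorem scalar_of_conj (h : CompAlg N conjO) (x : A) (hx : x = conjO x) :
    ∃ a : ℂ, x = a • (1 : A) := by
  refine ⟨polar N x 1 / 2, ?_⟩
  rw [h.hconj] at hx
  have h2 : (2 : ℂ) • x = polar N x 1 • (1 : A) := by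
    rw [two_smul]
    nth_rewrite 1 [hx]
    abel
  have h3 := congrArg (fun t => (2⁻¹ : ℂ) • t) h2
  simp only [smul_smul] at h3
  norm_num at h3
  exact h3.trans (by congr 1; ring)

theorem add_conj (h : CompAlg N conjO) (x : A) : x + conjO x = polar N x 1 • (1 : A) := by
  rw [h.hconj]; abel

theorem one_ne (h : CompAlg N conjO) : (1 : A) ≠ 0 := by
  intro h0
  have := h.hone
  rw [h0, map_zero] at this
  exact zero_ne_one this

theorem smul_one_inj (h : CompAlg N conjO) {a b : ℂ} (hab : a • (1 : A) = b • (1 : A)) : a = b := by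
  have := congrArg (fun t => polar N t 1) hab
  simp only [polar_smul_left, h.polar_one_one, smul_eq_mul] at this
  linear_combination this / 2

/-- The generic hermitian matrix. -/
def hm (conjO : A →ₗ[ℂ] A) (a b c : ℂ) (x y z : A) : Matrix (Fin 3) (Fin 3) A :=
  !![a • 1, x, conjO z; conjO x, b • 1, y; z, conjO y, c • 1]

theorem hm_mem (h : CompAlg N conjO) (a b c : ℂ) (x y z : A) :
    hm conjO a b c x y z ∈ HermSub conjO := by
  intro i j
  fin_cases i <;> fin_cases j <;> simp [hm, h.conj_conj, h.conj_one]

theorem exists_hm (h : CompAlg N conjO) (M : Matrix (Fin 3) (Fin 3) A) (hM : M ∈ HermSub conjO) :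
    ∃ a b c x y z, M = hm conjO a b c x y z := by
  obtain ⟨a, ha⟩ := h.scalar_of_conj (M 0 0) (hM 0 0)
  obtain ⟨b, hb⟩ := h.scalar_of_conj (M 1 1) (hM 1 1)
  obtain ⟨c, hc⟩ := h.scalar_of_conj (M 2 2) (hM 2 2)
  refine ⟨a, b, c, M 0 1, M 1 2, M 2 0, ?_⟩
  ext i j
  fin_cases i <;> fin_cases j <;> simp [hm, ha, hb, hc, ← hM _ _]

theorem hm_sq (h : CompAlg N conjO) (a b c : ℂ) (x y z : A) :
    hm conjO a b c x y z * hm conjO a b c x y z =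
      hm conjO (a ^ 2 + N x + N z) (b ^ 2 + N x + N y) (c ^ 2 + N y + N z)
        ((a + b) • x + conjO (y * z)) ((b + c) • y + conjO (z * x))
        ((c + a) • z + conjO (x * y)) := by
  ext i j
  rw [Matrix.mul_apply, Fin.sum_univ_three]
  fin_cases i <;> fin_cases j <;>
    simp [hm, h.conj_conj, h.conj_one, h.mul_conj, h.conj_mul_self, h.conj_mul, smul_smul,
      add_smul, pow_two] <;> abel

/-- Jordan automorphism of the hermitian matrices -/
def IsAut (conjO : A →ₗ[ℂ] A) (g : HermSub conjO ≃ₗ[ℂ] HermSub conjO) : Prop :=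
  ∀ X Y Z : HermSub conjO,
    (Z : Matrix (Fin 3) (Fin 3) A) = jord (X : Matrix (Fin 3) (Fin 3) A) Y →
      (g Z : Matrix (Fin 3) (Fin 3) A) = jord (g X : Matrix (Fin 3) (Fin 3) A) (g Y)

/-- being conjugate under the automorphism group -/
def Rel (conjO : A →ₗ[ℂ] A) (X Y : Matrix (Fin 3) (Fin 3) A) : Prop :=
  ∃ g : HermSub conjO ≃ₗ[ℂ] HermSub conjO, IsAut conjO g ∧
    ∀ hX : X ∈ HermSub conjO, (g ⟨X, hX⟩ : Matrix (Fin 3) (Fin 3) A) = Y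

theorem Rel.trans {X Y Z : Matrix (Fin 3) (Fin 3) A} (h1 : Rel conjO X Y) (h2 : Rel conjO Y Z) :
    Rel conjO X Z := by
  obtain ⟨g, hg, e⟩ := h1
  obtain ⟨k, hk, f⟩ := h2
  refine ⟨g.trans k, fun P Q R hR => hk _ _ _ (hg _ _ _ hR), fun hX => ?_⟩
  have hY : Y ∈ HermSub conjO := by rw [← e hX]; exact (g ⟨X, hX⟩).2
  have : g ⟨X, hX⟩ = ⟨Y, hY⟩ := Subtype.ext (e hX)
  simp only [LinearEquiv.trans_apply, this]
  exact f hY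

theorem jord_self (X : Matrix (Fin 3) (Fin 3) A) : jord X X = X * X := by
  rw [jord, ← two_smul ℂ, smul_smul]; norm_num

theorem Rel.sq {X Y : Matrix (Fin 3) (Fin 3) A} (h1 : Rel conjO X Y) (hX : X ∈ HermSub conjO)
    (h0 : X * X = 0) : Y * Y = 0 := by
  obtain ⟨g, hg, e⟩ := h1
  have := hg ⟨X, hX⟩ ⟨X, hX⟩ 0 (by simp [jord_self, h0])
  rw [jord_self, e hX] at this
  rw [← this]; simp

/-- A linear equivalence built from a pair of inverse maps on matrices. -/
theorem rel_of_maps (F G : Matrix (Fin 3) (Fin 3) A →ₗ[ℂ] Matrix (Fin 3) (Fin 3) A)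
    (hF : ∀ X ∈ HermSub conjO, F X ∈ HermSub conjO)
    (hG : ∀ X ∈ HermSub conjO, G X ∈ HermSub conjO)
    (hFG : ∀ X, F (G X) = X) (hGF : ∀ X, G (F X) = X)
    (hsq : ∀ X ∈ HermSub conjO, F (X * X) = F X * F X)
    (X : Matrix (Fin 3) (Fin 3) A) : Rel conjO X (F X) := by
  refine ⟨LinearEquiv.ofLinearMap (F.restrict hF) (G.restrict hG) ?_ ?_, ?_, ?_⟩
  · ext1 X; exact Subtype.ext (hFG _)
  · ext1 X; exact Subtype.ext (hGF _)
  · rintro ⟨X, hX⟩ ⟨Y, hY⟩ ⟨Z, hZ⟩ hh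
    simp only at hh
    subst hh
    simp only [LinearEquiv.coe_ofLinearMap, LinearMap.coe_restrict_apply, jord, map_smul]
    congr 1
    have h3 := hsq (X + Y) (Submodule.add_mem _ hX hY)
    simp only [add_mul, mul_add, map_add, hsq X hX, hsq Y hY] at h3
    rw [map_add]
    have : ∀ p q r s t u : Matrix (Fin 3) (Fin 3) A, p + q + (r + s) = p + t + (u + s) →
      q + r = t + u := by
      intro p q r s t u h
      have h' : p + s + (q + r) = p + s + (t + u) := by
        calc _ = p + q + (r + s) := by abel
          _ = _ := h
          _ = _ := by abel
      exact add_left_cancel h'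
    first
      | exact this _ _ _ _ _ _ h3
      | (rw [add_comm (F (X * Y)), add_comm (F X * F Y)]; exact this _ _ _ _ _ _ h3)
  · intro hX; rfl

/-- the triality map attached to `u` -/
def umap (conjO : A →ₗ[ℂ] A) (u : A) :
    Matrix (Fin 3) (Fin 3) A →ₗ[ℂ] Matrix (Fin 3) (Fin 3) A where
  toFun M := !![M 0 0, u * M 0 1, u * (M 0 2 * u); M 1 0 * conjO u, M 1 1, M 1 2 * u;
    conjO u * (M 2 0 * conjO u), conjO u * M 2 1, M 2 2]
  map_add' X Y := by
    ext i j
    fin_cases i <;> fin_cases j <;> simp [mul_add, add_mul]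
  map_smul' c X := by
    ext i j
    fin_cases i <;> fin_cases j <;> simp [smul_mul_assoc, mul_smul_comm]

theorem umap_hm (h : CompAlg N conjO) (u : A) (a b c : ℂ) (x y z : A) :
    umap conjO u (hm conjO a b c x y z) =
      hm conjO a b c (u * x) (y * u) (conjO u * (z * conjO u)) := by
  ext i j
  fin_cases i <;> fin_cases j <;> simp [umap, hm, h.conj_mul, h.conj_conj, h.flex]

theorem umap_inv (h : CompAlg N conjO) (u : A) (hu : N u = 1) (X : Matrix (Fin 3) (Fin 3) A) :
    umap conjO u (umap conjO (conjO u) X) = X := by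
  ext i j
  fin_cases i <;> fin_cases j <;>
    simp [umap, h.conj_conj, h.cancel_left', h.cancel_right', h.cancel_left, h.cancel_right, hu,
      h.flex]
  · rw [← h.flex (conjO u), h.cancel_right', hu, one_smul, h.cancel_left', hu, one_smul]
  · rw [← h.flex u, h.cancel_right, hu, one_smul, h.cancel_left, hu, one_smul]

theorem rel_u (h : CompAlg N conjO) (u : A) (hu : N u = 1) (a b c : ℂ) (x y z : A) :
    Rel conjO (hm conjO a b c x y z) (hm conjO a b c (u * x) (y * u) (conjO u * (z * conjO u))) := by
  rw [← h.umap_hm]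
  have hmem : ∀ v : A, ∀ X ∈ HermSub conjO, umap conjO v X ∈ HermSub conjO := by
    intro v X hX
    obtain ⟨a, b, c, x, y, z, rfl⟩ := h.exists_hm X hX
    rw [h.umap_hm]; exact h.hm_mem _ _ _ _ _ _
  refine rel_of_maps _ (umap conjO (conjO u)) (hmem _) (hmem _) (h.umap_inv u hu) ?_ ?_ _
  · intro X
    have := h.umap_inv (conjO u) (by rw [h.N_conj, hu]) X
    rwa [h.conj_conj] at this
  · intro X hX
    obtain ⟨a, b, c, x, y, z, rfl⟩ := h.exists_hm X hX
    rw [h.hm_sq, h.umap_hm, h.umap_hm, h.hm_sq]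
    simp only [h.hmul, h.N_conj, hu, one_mul, mul_one]
    have hu' : N (conjO u) = 1 := by rw [h.N_conj, hu]
    congr 1
    · rw [mul_add, mul_smul_comm]
      congr 1
      simp only [h.conj_mul, h.conj_conj]
      rw [h.flex, h.moufang_left, h.cancel_left', hu, one_smul]
    · rw [add_mul, smul_mul_assoc]
      congr 1
      simp only [h.conj_mul, h.conj_conj]
      rw [h.flex, h.moufang_right, h.cancel_right', hu, one_smul]
    · rw [add_mul, mul_add, smul_mul_assoc, mul_smul_comm]
      congr 1
      simp only [h.conj_mul, h.conj_conj]
      rw [h.moufang_mid']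

/-- conjugation by a scalar matrix -/
def pmap (P : Matrix (Fin 3) (Fin 3) ℂ) :
    Matrix (Fin 3) (Fin 3) A →ₗ[ℂ] Matrix (Fin 3) (Fin 3) A where
  toFun M := Matrix.of fun i j => ∑ k, ∑ l, (P i k * P j l) • M k l
  map_add' X Y := by
    ext i j
    simp [smul_add, Finset.sum_add_distrib]
  map_smul' c X := by
    ext i j
    simp only [Matrix.of_apply, Matrix.smul_apply, RingHom.id_apply, Finset.smul_sum]
    refine Finset.sum_congr rfl fun k _ => Finset.sum_congr rfl fun l _ => smul_comm _ _ _

theorem pmap_apply (P : Matrix (Fin 3) (Fin 3) ℂ) (M : Matrix (Fin 3) (Fin 3) A) (i j : Fin 3) :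
    pmap P M i j = ∑ k, ∑ l, (P i k * P j l) • M k l := rfl

theorem pmap_pmap (P Q : Matrix (Fin 3) (Fin 3) ℂ) (hPQ : P * Q = 1)
    (X : Matrix (Fin 3) (Fin 3) A) : pmap P (pmap Q X) = X := by
  have e : ∀ i j, ∑ k, P i k * Q k j = if i = j then 1 else 0 := by
    intro i j
    have := congrFun (congrFun hPQ i) j
    rwa [Matrix.mul_apply, Matrix.one_apply] at this
  ext i j
  simp only [pmap_apply, Finset.smul_sum, smul_smul]
  calc ∑ k, ∑ l, ∑ m, ∑ n, (P i k * P j l * (Q k m * Q l n)) • X m n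
      = ∑ m, ∑ n, ((∑ k, P i k * Q k m) * (∑ l, P j l * Q l n)) • X m n := by
        simp only [Fin.sum_univ_three]
        module
    _ = X i j := by
        simp [e]

theorem pmap_mul (P : Matrix (Fin 3) (Fin 3) ℂ) (hP : P.transpose * P = 1)
    (X Y : Matrix (Fin 3) (Fin 3) A) : pmap P (X * Y) = pmap P X * pmap P Y := by
  have e : ∀ i j, ∑ k, P k i * P k j = if i = j then 1 else 0 := by
    intro i j
    have := congrFun (congrFun hP i) j
    rwa [Matrix.mul_apply, Matrix.one_apply] at this
  ext i j
  symm
  simp only [pmap_apply, Matrix.mul_apply, Finset.sum_mul, Finset.mul_sum, Finset.smul_sum,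
    smul_mul_assoc, mul_smul_comm, smul_smul]
  calc _ = ∑ t, ∑ m, ∑ n, ∑ k, ∑ l, ((P i k * P j n) * (P t l * P t m)) • (X k l * Y m n) := by
        refine Finset.sum_congr rfl fun t _ => Finset.sum_congr rfl fun m _ =>
          Finset.sum_congr rfl fun n _ => Finset.sum_congr rfl fun k _ =>
            Finset.sum_congr rfl fun l _ => ?_
        congr 1
        ring
    _ = ∑ m, ∑ n, ∑ k, ∑ l, ((P i k * P j n) * (∑ t, P t l * P t m)) • (X k l * Y m n) := by
        simp only [Finset.mul_sum, Finset.sum_smul]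
        rw [Finset.sum_comm]
        refine Finset.sum_congr rfl fun k _ => ?_
        rw [Finset.sum_comm]
        refine Finset.sum_congr rfl fun l _ => ?_
        rw [Finset.sum_comm]
        refine Finset.sum_congr rfl fun m _ => ?_
        rw [Finset.sum_comm]
    _ = _ := by
        simp only [e]
        simp [Fin.sum_univ_three]
        abel

theorem rel_p (P : Matrix (Fin 3) (Fin 3) ℂ) (hP : P.transpose * P = 1)
    (X : Matrix (Fin 3) (Fin 3) A) : Rel conjO X (pmap P X) := by
  have hmem : ∀ Q : Matrix (Fin 3) (Fin 3) ℂ, ∀ X ∈ HermSub conjO, pmap Q X ∈ HermSub conjO := by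
    intro Q X hX i j
    simp only [pmap_apply, map_sum, map_smul]
    rw [Finset.sum_comm]
    refine Finset.sum_congr rfl fun k _ => Finset.sum_congr rfl fun l _ => ?_
    rw [← hX k l, mul_comm]
  exact rel_of_maps _ (pmap P.transpose) (hmem _) (hmem _)
    (pmap_pmap _ _ (mul_eq_one_comm.mp hP)) (pmap_pmap _ _ hP) (fun X _ => pmap_mul P hP X X) X

theorem rel_cyc (a b c : ℂ) (x y z : A) :
    Rel conjO (hm conjO a b c x y z) (hm conjO b c a y z x) := by
  convert rel_p (conjO := conjO) !![0, 1, 0; 0, 0, 1; 1, 0, 0] ?_ (hm conjO a b c x y z) using 1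
  · ext i j
    rw [pmap_apply]
    fin_cases i <;> fin_cases j <;> simp [hm, Fin.sum_univ_three]
  · ext i j
    fin_cases i <;> fin_cases j <;> simp [Matrix.mul_apply, Fin.sum_univ_three]

theorem rel_rot (h : CompAlg N conjO) (k s : ℂ) (hks : k ^ 2 + s ^ 2 = 1) (a b c : ℂ) (x y z : A) :
    Rel conjO (hm conjO a b c x y z)
      (hm conjO (k ^ 2 * a + s ^ 2 * b + k * s * polar N x 1)
        (s ^ 2 * a + k ^ 2 * b - k * s * polar N x 1) c
        ((k * s * (b - a)) • (1 : A) + k ^ 2 • x - s ^ 2 • conjO x)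
        (k • y - s • conjO z) (k • z + s • conjO y)) := by
  convert rel_p (conjO := conjO) !![k, s, 0; -s, k, 0; 0, 0, 1] ?_ (hm conjO a b c x y z) using 1
  · ext i j
    rw [pmap_apply]
    fin_cases i <;> fin_cases j <;>
      simp [hm, Fin.sum_univ_three, h.conj_conj, h.conj_one, h.hconj x, smul_sub, map_sub] <;>
      module
  · ext i j
    fin_cases i <;> fin_cases j <;> simp [Matrix.mul_apply, Fin.sum_univ_three] <;>
      first
        | linear_combination hks
        | ring1

/-- the cone conditions in coordinates -/
theorem hm_sq_zero (h : CompAlg N conjO) (a b c : ℂ) (x y z : A) (htr : a + b + c = 0)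
    (h0 : hm conjO a b c x y z * hm conjO a b c x y z = 0) :
    N x = a * b ∧ N y = b * c ∧ N z = c * a ∧ c • x = conjO (y * z) ∧ a • y = conjO (z * x) ∧
      b • z = conjO (x * y) := by
  rw [h.hm_sq] at h0
  have d0 : a ^ 2 + N x + N z = 0 := h.smul_one_inj (by simpa [hm] using congrFun₂ h0 0 0)
  have d1 : b ^ 2 + N x + N y = 0 := h.smul_one_inj (by simpa [hm] using congrFun₂ h0 1 1)
  have d2 : c ^ 2 + N y + N z = 0 := h.smul_one_inj (by simpa [hm] using congrFun₂ h0 2 2)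
  have e0 : (a + b) • x + conjO (y * z) = 0 := by simpa [hm] using congrFun₂ h0 0 1
  have e1 : (b + c) • y + conjO (z * x) = 0 := by simpa [hm] using congrFun₂ h0 1 2
  have e2 : (c + a) • z + conjO (x * y) = 0 := by simpa [hm] using congrFun₂ h0 2 0
  have hc : c = -(a + b) := by linear_combination htr
  refine ⟨?_, ?_, ?_, ?_, ?_, ?_⟩
  · subst hc; linear_combination (d0 + d1 - d2) / 2
  · subst hc; linear_combination (d1 + d2 - d0) / 2
  · subst hc; linear_combination (d0 + d2 - d1) / 2
  · rw [hc, neg_smul, neg_eq_iff_add_eq_zero]; exact e0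
  · rw [show a = -(b + c) by linear_combination htr, neg_smul, neg_eq_iff_add_eq_zero]; exact e1
  · rw [show b = -(c + a) by linear_combination htr, neg_smul, neg_eq_iff_add_eq_zero]; exact e2

theorem N_smul' (r : ℂ) (x : A) : N (r • x) = r ^ 2 * N x := by
  rw [QuadraticMap.map_smul, smul_eq_mul, pow_two]

/-- the target -/
abbrev tgt (conjO : A →ₗ[ℂ] A) : Matrix (Fin 3) (Fin 3) A :=
  hm conjO Complex.I (-Complex.I) 0 1 0 0

theorem step_block (h : CompAlg N conjO) (c : ℂ) (hc : c ≠ 0) (x : A) (hx : N x = - c ^ 2) :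
    Rel conjO (hm conjO c (-c) 0 x 0 0) (tgt conjO) := by
  have I2 : Complex.I ^ 2 = -1 := Complex.I_sq
  have hu : N ((Complex.I / c) • conjO x) = 1 := by
    rw [N_smul', h.N_conj, hx, div_pow, I2]; field_simp
  refine (h.rel_u _ hu c (-c) 0 x 0 0).trans ?_
  simp only [zero_mul, mul_zero, smul_mul_assoc, h.conj_mul_self, hx, smul_smul]
  obtain ⟨w, hw⟩ := IsAlgClosed.exists_pow_nat_eq (Complex.I / c) (n := 2) (by norm_num)
  have hw0 : w ≠ 0 := by
    rintro rfl
    have : Complex.I / c ≠ 0 := div_ne_zero Complex.I_ne_zero hc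
    exact this (by rw [← hw]; norm_num)
  have hcw : c * w ^ 2 = Complex.I := by rw [hw]; field_simp
  have hww : w * w⁻¹ = 1 := mul_inv_cancel₀ hw0
  set v := w⁻¹ with hv
  set k := (w + v) / 2 with hk
  set s := Complex.I * (w - v) / 2 with hs
  have hks : k ^ 2 + s ^ 2 = 1 := by
    rw [hk, hs]; linear_combination (w - v) ^ 2 / 4 * I2 + hww
  have hr : Complex.I / c * -c ^ 2 = -Complex.I * c := by field_simp
  have hkm : k - Complex.I * s = w := by
    rw [hk, hs]; linear_combination -(w - v) / 2 * I2
  have key : c * (k ^ 2 - s ^ 2 - 2 * Complex.I * k * s) = Complex.I := by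
    have hk2 : c * (k - Complex.I * s) ^ 2 = Complex.I := by rw [hkm, hcw]
    clear_value k s
    linear_combination hk2 - c * s ^ 2 * I2
  rw [hr]
  convert h.rel_rot k s hks c (-c) 0 ((-Complex.I * c) • (1 : A)) 0 0 using 1
  simp only [polar_smul_left, h.polar_one_one, map_smul, h.conj_one, smul_eq_mul, map_zero,
    smul_zero, sub_zero, add_zero, smul_smul, ← add_smul, ← sub_smul]
  unfold tgt
  congr 1
  · linear_combination -key
  · linear_combination key
  · refine (one_smul ℂ (1 : A)).symm.trans ?_
    congr 1
    linear_combination Complex.I * key + (1 + 2 * c * k * s) * I2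

/-- the generic case -/
theorem step_generic (h : CompAlg N conjO) (a b c : ℂ) (x y z : A) (htr : a + b + c = 0)
    (h0 : hm conjO a b c x y z * hm conjO a b c x y z = 0) (ha : a ≠ 0) (hb : b ≠ 0) (hc : c ≠ 0) :
    Rel conjO (hm conjO a b c x y z) (tgt conjO) := by
  obtain ⟨hx, -⟩ := h.hm_sq_zero a b c x y z htr h0
  obtain ⟨p, hp⟩ := IsAlgClosed.exists_pow_nat_eq a (n := 2) (by norm_num)
  obtain ⟨q, hq⟩ := IsAlgClosed.exists_pow_nat_eq b (n := 2) (by norm_num)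
  obtain ⟨r, hr⟩ := IsAlgClosed.exists_pow_nat_eq (-c) (n := 2) (by norm_num)
  have hp0 : p ≠ 0 := by rintro rfl; exact ha (by rw [← hp]; norm_num)
  have hq0 : q ≠ 0 := by rintro rfl; exact hb (by rw [← hq]; norm_num)
  have hr0 : r ≠ 0 := by rintro rfl; exact hc (by rw [← neg_neg c, ← hr]; norm_num)
  have hu : N ((1 / (p * q)) • conjO x) = 1 := by
    rw [N_smul', h.N_conj, hx, ← hp, ← hq]; field_simp
  have hpq : p ^ 2 + q ^ 2 = r ^ 2 := by rw [hp, hq, hr]; linear_combination htr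
  have R1 := h.rel_u _ hu a b c x y z
  simp only [smul_mul_assoc, h.conj_mul_self, hx, smul_smul] at R1
  have hxi : 1 / (p * q) * (a * b) = p * q := by rw [← hp, ← hq]; field_simp
  rw [hxi] at R1
  generalize y * (1 / (p * q)) • conjO x = y1 at R1
  generalize conjO ((1 / (p * q)) • conjO x) * (z * conjO ((1 / (p * q)) • conjO x)) = z1 at R1
  have R2 := h.rel_rot (p / r) (q / r) (by field_simp; exact hpq) a b c ((p * q) • (1 : A)) y1 z1
  have R3 := R1.trans R2
  generalize (p / r) • y1 - (q / r) • conjO z1 = y2 at R3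
  generalize (p / r) • z1 + (q / r) • conjO y1 = z2 at R3
  simp only [polar_smul_left, h.polar_one_one, map_smul, h.conj_one, smul_eq_mul,
    smul_smul, ← add_smul, ← sub_smul] at R3
  have ea : (p / r) ^ 2 * a + (q / r) ^ 2 * b + p / r * (q / r) * (p * q * 2) = -c := by
    rw [← hp, ← hq, ← hr]; field_simp; linear_combination (p ^ 2 + q ^ 2 + r ^ 2) * hpq
  have eb : (q / r) ^ 2 * a + (p / r) ^ 2 * b - p / r * (q / r) * (p * q * 2) = 0 := by
    rw [← hp, ← hq]; field_simp; ring
  have ex : p / r * (q / r) * (b - a) + (p / r) ^ 2 * (p * q) - (q / r) ^ 2 * (p * q) = 0 := by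
    rw [← hp, ← hq]; field_simp; ring
  rw [ea, eb, ex, zero_smul] at R3
  have h3 := R3.sq (h.hm_mem _ _ _ _ _ _) h0
  obtain ⟨-, -, hz, -, hy, -⟩ := h.hm_sq_zero _ _ _ _ _ _ (by ring) h3
  rw [mul_zero, map_zero, smul_eq_zero] at hy
  have hy2 : y2 = 0 := hy.resolve_left (neg_ne_zero.mpr hc)
  subst hy2
  refine R3.trans ((rel_cyc _ _ _ _ _ _).trans ((rel_cyc _ _ _ _ _ _).trans ?_))
  exact h.step_block c hc z2 (by rw [hz]; ring)

theorem step_c (h : CompAlg N conjO) (a b c : ℂ) (x y z : A) (htr : a + b + c = 0)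
    (h0 : hm conjO a b c x y z * hm conjO a b c x y z = 0) (hc : c ≠ 0) :
    Rel conjO (hm conjO a b c x y z) (tgt conjO) := by
  by_cases hab : a ≠ 0 ∧ b ≠ 0
  · exact h.step_generic a b c x y z htr h0 hab.1 hab.2 hc
  have rot : ∀ k s : ℂ, k ^ 2 + s ^ 2 = 1 →
      k ^ 2 * a + s ^ 2 * b + k * s * polar N x 1 ≠ 0 →
      s ^ 2 * a + k ^ 2 * b - k * s * polar N x 1 ≠ 0 →
      Rel conjO (hm conjO a b c x y z) (tgt conjO) := by
    intro k s hks h1 h2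
    have R := h.rel_rot k s hks a b c x y z
    refine R.trans (h.step_generic _ _ _ _ _ _ ?_ (R.sq (h.hm_mem _ _ _ _ _ _) h0) h1 h2 hc)
    linear_combination (a + b) * hks + htr
  have hcab : c = -(a + b) := by linear_combination htr
  obtain ⟨t, ht⟩ := IsAlgClosed.exists_pow_nat_eq (1 / 2 : ℂ) (n := 2) (by norm_num)
  set T := polar N x 1
  by_cases h1 : a + b + T = 0
  · have hT : T = -(a + b) := by linear_combination h1
    have hne : a + b ≠ 0 := by rintro h2; exact hc (by rw [hcab, h2, neg_zero])
    have hz : a = 0 ∨ b = 0 := by tauto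
    refine rot (3 / 5) (4 / 5) (by norm_num) ?_ ?_ <;> rw [hT] <;> rcases hz with rfl | rfl <;>
      intro h3 <;> apply hne
    · linear_combination 25 / 4 * h3
    · linear_combination -25 / 3 * h3
    · linear_combination 25 / 21 * h3
    · linear_combination 25 / 28 * h3
  by_cases h2 : a + b - T = 0
  · have hT : T = a + b := by linear_combination -h2
    have hne : a + b ≠ 0 := by rintro h2; exact hc (by rw [hcab, h2, neg_zero])
    have hz : a = 0 ∨ b = 0 := by tauto
    refine rot (3 / 5) (4 / 5) (by norm_num) ?_ ?_ <;> rw [hT] <;> rcases hz with rfl | rfl <;>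
      intro h3 <;> apply hne
    · linear_combination 25 / 28 * h3
    · linear_combination 25 / 21 * h3
    · linear_combination -25 / 3 * h3
    · linear_combination 25 / 4 * h3
  refine rot t t (by rw [ht]; norm_num) ?_ ?_
  · intro h3
    exact h1 (by linear_combination 2 * h3 - 2 * (a + b + T) * ht)
  · intro h3
    exact h2 (by linear_combination 2 * h3 - 2 * (a + b - T) * ht)

theorem step_any (h : CompAlg N conjO) (a b c : ℂ) (x y z : A) (htr : a + b + c = 0)
    (h0 : hm conjO a b c x y z * hm conjO a b c x y z = 0) (hne : a ≠ 0 ∨ b ≠ 0 ∨ c ≠ 0) :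
    Rel conjO (hm conjO a b c x y z) (tgt conjO) := by
  have R1 := rel_cyc (conjO := conjO) a b c x y z
  have R2 := R1.trans (rel_cyc (conjO := conjO) _ _ _ _ _ _)
  rcases hne with ha | hb | hc
  · exact R1.trans (h.step_c _ _ _ _ _ _ (by linear_combination htr)
      (R1.sq (h.hm_mem _ _ _ _ _ _) h0) ha)
  · exact R2.trans (h.step_c _ _ _ _ _ _ (by linear_combination htr)
      (R2.sq (h.hm_mem _ _ _ _ _ _) h0) hb)
  · exact h.step_c _ _ _ _ _ _ htr h0 hc

theorem step_null (h : CompAlg N conjO) (x y z : A)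
    (h0 : hm conjO 0 0 0 x y z * hm conjO 0 0 0 x y z = 0) (hne : x ≠ 0) :
    Rel conjO (hm conjO 0 0 0 x y z) (tgt conjO) := by
  obtain ⟨hx, -⟩ := h.hm_sq_zero 0 0 0 x y z (by ring) h0
  have hw : ∃ w, polar N x w ≠ 0 ∧ N w ≠ 0 := by
    have : ∃ w, polar N x w ≠ 0 := by
      by_contra! hcon
      exact hne (h.hnondeg x hcon)
    obtain ⟨w, hw⟩ := this
    by_cases hNw : N w = 0
    · refine ⟨w + x, ?_, ?_⟩
      · rw [polar_add_right, polar_self, hx]; simpa using hw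
      · rw [N_add, hNw, hx, polar_comm]; simpa using hw
    · exact ⟨w, hw, hNw⟩
  obtain ⟨w, hw1, hw2⟩ := hw
  obtain ⟨n, hn⟩ := IsAlgClosed.exists_pow_nat_eq (N w) (n := 2) (by norm_num)
  have hn0 : n ≠ 0 := by rintro rfl; exact hw2 (by rw [← hn]; norm_num)
  have hu : N (n⁻¹ • conjO w) = 1 := by
    rw [N_smul', h.N_conj, ← hn]; field_simp
  have R1 := h.rel_u _ hu 0 0 0 x y z
  obtain ⟨t, ht⟩ := IsAlgClosed.exists_pow_nat_eq (1 / 2 : ℂ) (n := 2) (by norm_num)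
  have R2 := R1.trans (h.rel_rot t t (by rw [ht]; norm_num) _ _ _ _ _ _)
  refine R2.trans (h.step_any _ _ _ _ _ _ (by ring) (R2.sq (h.hm_mem _ _ _ _ _ _) h0) (Or.inl ?_))
  rw [smul_mul_assoc, polar_smul_left, h.adj_left, h.conj_conj, mul_one, ← pow_two, ht]
  simp [hn0, hw1]

theorem main (h : CompAlg N conjO) (M : Matrix (Fin 3) (Fin 3) A) (hH : M ∈ HermSub conjO)
    (htr : Matrix.trace M = 0) (hsq : M * M = 0) (hne : M ≠ 0) : Rel conjO M (tgt conjO) := by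
  obtain ⟨a, b, c, x, y, z, rfl⟩ := h.exists_hm M hH
  have htr' : a + b + c = 0 := by
    apply h.smul_one_inj
    simpa [Matrix.trace, hm, Fin.sum_univ_three, add_smul] using htr
  by_cases hd : a ≠ 0 ∨ b ≠ 0 ∨ c ≠ 0
  · exact h.step_any _ _ _ _ _ _ htr' hsq hd
  push Not at hd
  obtain ⟨rfl, rfl, rfl⟩ := hd
  have R1 := rel_cyc (conjO := conjO) 0 0 0 x y z
  have R2 := R1.trans (rel_cyc (conjO := conjO) _ _ _ _ _ _)
  by_cases hx : x = 0
  · by_cases hy : y = 0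
    · by_cases hz : z = 0
      · exfalso
        apply hne
        subst hx hy hz
        ext i j
        fin_cases i <;> fin_cases j <;> simp [hm]
      · exact R2.trans (h.step_null _ _ _ (R2.sq hH hsq) hz)
    · exact R1.trans (h.step_null _ _ _ (R1.sq hH hsq) hy)
  · exact h.step_null _ _ _ hsq hx

end CompAlg
/-- `F₄(ℂ) = Aut(Herm(3,O), ∘)` acts transitively on the cone over the hyperplane
section of the complex Cayley plane: every nonzero traceless `A ∈ Herm(3,O)` with
`A² = 0` can be mapped by an automorphism of the Jordan algebra to
`[[i,1,0],[1,−i,0],[0,0,0]]`. -/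
theorem f4_transitive_on_cone (N : QuadraticForm ℂ A)
    (hmul : ∀ x y : A, N (x * y) = N x * N y)
    (hnondeg : ∀ x : A, (∀ y : A, polar N x y = 0) → x = 0)
    (hdim : Module.finrank ℂ A = 8)
    (conjO : A →ₗ[ℂ] A)
    (hconj : ∀ x : A, conjO x = polar N x 1 • (1 : A) - x)
    (M : Matrix (Fin 3) (Fin 3) A) (hH : M ∈ HermSub conjO)
    (htr : Matrix.trace M = 0) (hsq : M * M = 0) (hne : M ≠ 0) :
    ∃ g : HermSub conjO ≃ₗ[ℂ] HermSub conjO,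
      (∀ X Y Z : HermSub conjO,
        (Z : Matrix (Fin 3) (Fin 3) A) = jord (X : Matrix (Fin 3) (Fin 3) A) Y →
          (g Z : Matrix (Fin 3) (Fin 3) A) = jord (g X : Matrix (Fin 3) (Fin 3) A) (g Y)) ∧
      (g ⟨M, hH⟩ : Matrix (Fin 3) (Fin 3) A)
        = !![Complex.I • 1, 1, 0; 1, (-Complex.I) • 1, 0; 0, 0, 0] := by

  have hone : N 1 = 1 := by
    have h1 := hmul 1 1
    rw [mul_one] at h1
    have h2 : N 1 * (N 1 - 1) = 0 := by linear_combination -h1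
    rcases mul_eq_zero.mp h2 with h3 | h3
    · exfalso
      have hN : ∀ x, N x = 0 := by
        intro x
        have := hmul x 1
        rwa [mul_one, h3, mul_zero] at this
      have hz : ∀ x : A, x = 0 := fun x => hnondeg x (fun y => by simp [polar, hN])
      have : Subsingleton A := ⟨fun x y => by rw [hz x, hz y]⟩
      rw [Module.finrank_zero_of_subsingleton] at hdim
      norm_num at hdim
    · linear_combination h3
  have h : CompAlg N conjO := ⟨hmul, hnondeg, hone, hconj⟩
  obtain ⟨g, hg, e⟩ := h.main M hH htr hsq hne
  refine ⟨g, hg, ?_⟩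
  rw [e hH]
  ext i j
  fin_cases i <;> fin_cases j <;> simp [CompAlg.hm, h.conj_one]
end
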